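/- arXiv:2009.03643 — 3 statements merged into one kernel-verified Lean document; each statement's English description precedes it below -/
import Mathlib

section
/- Let D be a nonempty convex open set in ℝ^d satisfying Condition B. Then for every continuous w : [0,∞) → ℝ^d with w(0) ∈ D̄ there exists a unique solution (X, φ) of the Skorohod equation X = w + φ, and the solution map w ↦ X is continuous with respect to the topology of uniform convergence on compact subsets of [0,∞). -/
open MeasureTheory Set Filter Topology
open scoped RealInnerProductSpace

noncomputable section

abbrev Euc (d : ℕ) := EuclideanSpace ℝ (Fin d)

/-- Measure data representing the Lebesgue–Stieltjes measures `dφ` (componentwise, as a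
difference of locally finite nonnegative measures) and `d|φ|` (the total variation measure)
of a function `φ : [0,∞) → ℝ^d` of locally bounded variation. -/
structure BVMeasureData (d : ℕ) (φ : ℝ → Euc d) where
  pos : Fin d → Measure ℝ
  neg : Fin d → Measure ℝ
  var : Measure ℝ
  pos_fin : ∀ i : Fin d, ∀ t : ℝ, pos i (Icc 0 t) < ⊤
  neg_fin : ∀ i : Fin d, ∀ t : ℝ, neg i (Icc 0 t) < ⊤
  increments : ∀ i : Fin d, ∀ s t : ℝ, 0 ≤ s → s ≤ t →
    (pos i (Ioc s t)).toReal - (neg i (Ioc s t)).toReal = φ t i - φ s i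
  var_eq : ∀ s t : ℝ, 0 ≤ s → s ≤ t → var (Ioc s t) = eVariationOn φ (Icc s t)

/-- The Stieltjes integral `∫_{(s,t]} ⟨f(τ), dφ(τ)⟩`. -/
def BVMeasureData.pairing {d : ℕ} {φ : ℝ → Euc d} (M : BVMeasureData d φ)
    (f : ℝ → Euc d) (s t : ℝ) : ℝ :=
  ∑ i : Fin d, ((∫ τ in Ioc s t, f τ i ∂(M.pos i)) - ∫ τ in Ioc s t, f τ i ∂(M.neg i))

/-- `f` is right-continuous at every `t ≥ 0`. -/
def RightContinuousOnNonneg {E : Type*} [TopologicalSpace E] (f : ℝ → E) : Prop :=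
  ∀ t : ℝ, 0 ≤ t → ContinuousWithinAt f (Ici t) t

/-- `f` has left limits at every `t > 0`. -/
def HasLeftLimitsOnPos {E : Type*} [TopologicalSpace E] (f : ℝ → E) : Prop :=
  ∀ t : ℝ, 0 < t → ∃ L, Tendsto f (𝓝[<] t) (𝓝 L)

/-- `φ` is associated with `X` (relative to the convex domain `D`):
`φ` is rcll of locally bounded variation with `φ(0) = 0`, the measure `d|φ|` does not
charge `{t ≥ 0 : X(t) ∈ D}`, and `∫_{(s,t]} ⟨η(τ) − X(τ), dφ(τ)⟩ ≥ 0` for every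
continuous `η : [0,∞) → closure D`. -/
structure IsAssociated {d : ℕ} (D : Set (Euc d)) (X : ℝ → Euc d) (φ : ℝ → Euc d)
    (M : BVMeasureData d φ) : Prop where
  rightCont : RightContinuousOnNonneg φ
  leftLim : HasLeftLimitsOnPos φ
  bv : ∀ t : ℝ, 0 ≤ t → eVariationOn φ (Icc 0 t) < ⊤
  init : φ 0 = 0
  carried : M.var {t : ℝ | 0 ≤ t ∧ X t ∈ D} = 0
  normal : ∀ η : ℝ → Euc d, Continuous η → (∀ t : ℝ, 0 ≤ t → η t ∈ closure D) →
    ∀ s t : ℝ, 0 ≤ s → s ≤ t → 0 ≤ M.pairing (fun τ => η τ - X τ) s t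

/-- `(X, φ)` (with measure data `M` for `φ`) solves the Skorohod equation `X = w + φ`
for the domain `D`. -/
structure IsSkorohodSolution {d : ℕ} (D : Set (Euc d)) (w X φ : ℝ → Euc d)
    (M : BVMeasureData d φ) : Prop where
  rightCont : RightContinuousOnNonneg X
  leftLim : HasLeftLimitsOnPos X
  mem : ∀ t : ℝ, 0 ≤ t → X t ∈ closure D
  eqn : ∀ t : ℝ, 0 ≤ t → X t = w t + φ t
  assoc : IsAssociated D X φ M


/-- Condition B: there exist `ε > 0` and `δ > 0` such that every boundary point `x` of `D`
admits a point `x₀` with `B_ε(x₀) ⊆ D` and `|x − x₀| ≤ δ`. -/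
def ConditionB {d : ℕ} (D : Set (Euc d)) : Prop :=
  ∃ ε : ℝ, 0 < ε ∧ ∃ δ : ℝ, 0 < δ ∧
    ∀ x ∈ frontier D, ∃ x₀ : Euc d, Metric.ball x₀ ε ⊆ D ∧ dist x x₀ ≤ δ

set_option linter.unusedSectionVars false
section DiscretePart

variable {E : Type*} [NormedAddCommGroup E] [InnerProductSpace ℝ E]

/-- Discrete variation. -/
def SV (φ : ℕ → E) (m : ℕ) : ℝ := ∑ k ∈ Finset.range m, ‖φ (k + 1) - φ k‖

lemma SV_zero (φ : ℕ → E) : SV φ 0 = 0 := by simp [SV]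

lemma SV_succ (φ : ℕ → E) (m : ℕ) : SV φ (m + 1) = SV φ m + ‖φ (m + 1) - φ m‖ := by
  simp [SV, Finset.sum_range_succ]

lemma SV_nonneg (φ : ℕ → E) (m : ℕ) : 0 ≤ SV φ m :=
  Finset.sum_nonneg fun _ _ => norm_nonneg _

lemma SV_shift (φ : ℕ → E) (j m : ℕ) :
    SV φ (j + m) = SV φ j + SV (fun k => φ (j + k)) m := by
  induction m with
  | zero => simp [SV_zero]
  | succ m ih => rw [← add_assoc, SV_succ, SV_succ, ih]; simp only [add_assoc]

lemma SV_mono (φ : ℕ → E) {a b : ℕ} (h : a ≤ b) : SV φ a ≤ SV φ b := by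
  obtain ⟨c, rfl⟩ := Nat.exists_eq_add_of_le h
  rw [SV_shift]; linarith [SV_nonneg (fun k => φ (a + k)) c]

lemma norm_sub_le_SV_sub (φ : ℕ → E) {a b : ℕ} (h : a ≤ b) :
    ‖φ b - φ a‖ ≤ SV φ b - SV φ a := by
  induction b, h using Nat.le_induction with
  | base => simp
  | succ n hn ih =>
    rw [SV_succ]
    have : φ (n + 1) - φ a = (φ (n + 1) - φ n) + (φ n - φ a) := by abel
    rw [this]
    linarith [norm_add_le (φ (n + 1) - φ n) (φ n - φ a)]

/-- approximate discrete normality up to index `m`. -/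
structure DSol (C : Set E) (e : ℕ → ℝ) (X φ : ℕ → E) (m : ℕ) : Prop where
  mem : ∀ k ≤ m, X k ∈ C
  nrm : ∀ k < m, ∀ y ∈ C, - e k ≤ inner ℝ (y - X (k + 1)) (φ (k + 1) - φ k)

lemma DSol.mono {C : Set E} {e : ℕ → ℝ} {X φ : ℕ → E} {m n : ℕ} (h : DSol C e X φ m)
    (hn : n ≤ m) : DSol C e X φ n :=
  ⟨fun k hk => h.mem k (hk.trans hn), fun k hk => h.nrm k (hk.trans_le hn)⟩

lemma DSol.shift {C : Set E} {e : ℕ → ℝ} {X φ : ℕ → E} {m n : ℕ} (j : ℕ) (h : DSol C e X φ m)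
    (hn : j + n ≤ m) : DSol C (fun k => e (j + k)) (fun k => X (j + k)) (fun k => φ (j + k)) n :=
  ⟨fun k hk => h.mem _ (by omega), fun k hk => h.nrm (j + k) (by omega)⟩

lemma DSol.const {C : Set E} {x : E} (hx : x ∈ C) (p : E) (m : ℕ) :
    DSol C (fun _ => 0) (fun _ => x) (fun _ => p) m :=
  ⟨fun _ _ => hx, fun _ _ _ _ => by simp⟩

lemma DSol.key {C : Set E} {e e' : ℕ → ℝ} {X φ X' φ' : ℕ → E} {m : ℕ}
    (h : DSol C e X φ m) (h' : DSol C e' X' φ' m) (ω : ℝ)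
    (hω : ∀ k ≤ m, ‖(X k - φ k) - (X' k - φ' k)‖ ≤ ω) :
    ‖φ m - φ' m‖ ^ 2 ≤ ‖φ 0 - φ' 0‖ ^ 2 + 2 * (∑ k ∈ Finset.range m, (e k + e' k))
      + 2 * ω * (SV φ m + SV φ' m) := by
  induction m with
  | zero => simp [SV_zero]
  | succ m ih =>
    have ih := ih (h.mono (Nat.le_succ m)) (h'.mono (Nat.le_succ m))
      (fun k hk => hω k (hk.trans (Nat.le_succ m)))
    rw [SV_succ, SV_succ, Finset.sum_range_succ]
    have h1 := h.nrm m (Nat.lt_succ_self m) _ (h'.mem (m + 1) le_rfl)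
    have h2 := h'.nrm m (Nat.lt_succ_self m) _ (h.mem (m + 1) le_rfl)
    have h3 := hω (m + 1) le_rfl
    set a := φ (m + 1) with ha
    set b := φ m
    set a' := φ' (m + 1)
    set b' := φ' m
    set x := X (m + 1)
    set x' := X' (m + 1)
    have e1 : ‖a - a'‖ ^ 2 = ‖b - b'‖ ^ 2 + 2 * inner ℝ (a - a') ((a - b) - (a' - b'))
        - ‖(a - b) - (a' - b')‖ ^ 2 := by
      have : b - b' = (a - a') - ((a - b) - (a' - b')) := by abel
      rw [this, norm_sub_sq_real (a - a') ((a - b) - (a' - b'))]; ring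
    have e2 : inner ℝ (a - a') ((a - b) - (a' - b')) =
        - inner ℝ (x' - x) (a - b) - inner ℝ (x - x') (a' - b')
        - inner ℝ ((x - a) - (x' - a')) ((a - b) - (a' - b')) := by
      have : a - a' = (x - x') - ((x - a) - (x' - a')) := by abel
      rw [this, inner_sub_left, inner_sub_right (x - x'), ← neg_sub x x', inner_neg_left]
      ring
    have e3 : - inner ℝ ((x - a) - (x' - a')) ((a - b) - (a' - b')) ≤
        ω * (‖a - b‖ + ‖a' - b'‖) := by
      have := abs_real_inner_le_norm ((x - a) - (x' - a')) ((a - b) - (a' - b'))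
      have h4 := norm_sub_le (a - b) (a' - b')
      have h5 := neg_abs_le (inner ℝ ((x - a) - (x' - a')) ((a - b) - (a' - b')))
      have : ‖(x - a) - (x' - a')‖ * ‖(a - b) - (a' - b')‖ ≤ ω * (‖a - b‖ + ‖a' - b'‖) :=
        mul_le_mul h3 h4 (norm_nonneg _) ((norm_nonneg _).trans h3)
      linarith
    have := sq_nonneg ‖(a - b) - (a' - b')‖
    linarith

lemma ball_inner {C : Set E} {x₀ x v : E} {ε e : ℝ} (hε : 0 < ε)
    (hC : Metric.closedBall x₀ ε ⊆ C) (h : ∀ y ∈ C, - e ≤ inner ℝ (y - x) v) (he : 0 ≤ e) :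
    ε * ‖v‖ ≤ inner ℝ (x₀ - x) v + e := by
  by_cases hv : v = 0
  · simp [hv, he]
  have hv' : 0 < ‖v‖ := norm_pos_iff.mpr hv
  have := h (x₀ - (ε / ‖v‖) • v) (hC (by
    rw [Metric.mem_closedBall, dist_eq_norm, sub_sub_cancel_left, norm_neg, norm_smul,
      Real.norm_of_nonneg (by positivity)]
    rw [div_mul_cancel₀ _ hv'.ne']))
  have e1 : inner ℝ (x₀ - (ε / ‖v‖) • v - x) v = inner ℝ (x₀ - x) v - ε * ‖v‖ := by
    have : x₀ - (ε / ‖v‖) • v - x = (x₀ - x) - (ε / ‖v‖) • v := by abel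
    rw [this, inner_sub_left, inner_smul_left, real_inner_self_eq_norm_sq]
    simp only [conj_trivial]
    field_simp
  linarith

lemma DSol.pre_bound {C : Set E} {e : ℕ → ℝ} {X φ : ℕ → E} {m : ℕ}
    (h : DSol C e X φ m) (he : ∀ k, 0 ≤ e k) {x₀ : E} {ε : ℝ} (hε : 0 < ε)
    (hC : Metric.closedBall x₀ ε ⊆ C) (ω : ℝ)
    (hω : ∀ k ≤ m, ‖(X k - φ k) - (X 0 - φ 0)‖ ≤ ω) :
    ε * SV φ m ≤ - (1 / 2) * ‖φ m - φ 0‖ ^ 2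
      + inner ℝ (x₀ - X 0) (φ m - φ 0) + ω * SV φ m + ∑ k ∈ Finset.range m, e k := by
  induction m with
  | zero => simp [SV_zero]
  | succ m ih =>
    have ih := ih (h.mono (Nat.le_succ m)) (fun k hk => hω k (hk.trans (Nat.le_succ m)))
    rw [SV_succ, Finset.sum_range_succ]
    have h1 := ball_inner hε hC (h.nrm m (Nat.lt_succ_self m)) (he m)
    have h3 := hω (m + 1) le_rfl
    set a := φ (m + 1) with ha
    set b := φ m
    set x := X (m + 1)
    have e1 : inner ℝ (x₀ - x) (a - b) = inner ℝ (x₀ - X 0) (a - b) - inner ℝ (a - φ 0) (a - b) -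
        inner ℝ ((x - a) - (X 0 - φ 0)) (a - b) := by
      rw [← inner_sub_left, ← inner_sub_left]; congr 1; abel
    have e2 : ‖b - φ 0‖ ^ 2 = ‖a - φ 0‖ ^ 2 - 2 * inner ℝ (a - φ 0) (a - b) + ‖a - b‖ ^ 2 := by
      have : b - φ 0 = (a - φ 0) - (a - b) := by abel
      rw [this, norm_sub_sq_real]
    have e3 : inner ℝ (x₀ - X 0) (a - φ 0) =
        inner ℝ (x₀ - X 0) (b - φ 0) + inner ℝ (x₀ - X 0) (a - b) := by
      rw [← inner_add_right]; congr 1; abel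
    have h4 := abs_real_inner_le_norm ((x - a) - (X 0 - φ 0)) (a - b)
    have h5 := neg_abs_le (inner ℝ ((x - a) - (X 0 - φ 0)) (a - b))
    have h7 := mul_le_mul_of_nonneg_right h3 (norm_nonneg (a - b))
    have h8 := sq_nonneg ‖a - b‖
    linarith

lemma DSol.bound {C : Set E} {e : ℕ → ℝ} {X φ : ℕ → E} {m : ℕ}
    (h : DSol C e X φ m) (he : ∀ k, 0 ≤ e k) (he1 : ∑ k ∈ Finset.range m, e k ≤ 1)
    {x₀ : E} {ε : ℝ} (hε : 0 < ε)
    (hC : Metric.closedBall x₀ ε ⊆ C)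
    (hω : ∀ k ≤ m, ‖(X k - φ k) - (X 0 - φ 0)‖ ≤ ε / 7) :
    SV φ m ≤ (2 / ε) * (3 + ‖X 0 - x₀‖ ^ 2) := by
  have h1 := h.pre_bound he hε hC _ hω
  have h5 := (le_abs_self _).trans (abs_real_inner_le_norm (x₀ - X 0) (φ m - φ 0))
  rw [norm_sub_rev] at h5
  have h6 := sq_nonneg (‖X 0 - x₀‖ - ‖φ m - φ 0‖)
  have h8 := sq_nonneg ‖X 0 - x₀‖
  have h9 : 0 ≤ ε * SV φ m := mul_nonneg hε.le (SV_nonneg _ _)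
  have h7 : ε * SV φ m ≤ 2 * (3 + ‖X 0 - x₀‖ ^ 2) := by linarith
  rw [div_mul_eq_mul_div, le_div_iff₀ hε]
  linarith

/-- recursive variation bounds. -/
def KB (ε R : ℝ) : ℕ → ℝ
  | 0 => 0
  | N + 1 => KB ε R N + (2 / ε) * (3 + (R + N * (ε / 7) + KB ε R N) ^ 2)

lemma KB_nonneg {ε R : ℝ} (hε : 0 < ε) (N : ℕ) : 0 ≤ KB ε R N := by
  induction N with
  | zero => simp [KB]
  | succ N ih => rw [KB]; positivity

lemma DSol.chain {C : Set E} {e : ℕ → ℝ} {X φ : ℕ → E} {m : ℕ} {κ : ℕ → ℕ} (hκ : Monotone κ)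
    (hκ0 : κ 0 = 0) {N : ℕ} (hm : κ N = m)
    (h : DSol C e X φ m) (he : ∀ k, 0 ≤ e k) (he1 : ∑ k ∈ Finset.range m, e k ≤ 1)
    {x₀ : E} {ε R : ℝ} (hε : 0 < ε)
    (hC : Metric.closedBall x₀ ε ⊆ C) (hR : ‖X 0 - x₀‖ ≤ R)
    (hω : ∀ j < N, ∀ k, κ j ≤ k → k ≤ κ (j + 1) →
      ‖(X k - φ k) - (X (κ j) - φ (κ j))‖ ≤ ε / 7) :
    SV φ m ≤ KB ε R N := by
  have key : ∀ n ≤ N, SV φ (κ n) ≤ KB ε R n ∧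
      ‖(X (κ n) - φ (κ n)) - (X 0 - φ 0)‖ ≤ n * (ε / 7) := by
    intro n
    induction n with
    | zero => intro _; simp [hκ0, SV_zero, KB]
    | succ n ih =>
      intro hn
      obtain ⟨i1, i2⟩ := ih (by omega)
      have hle : κ n ≤ κ (n + 1) := hκ (Nat.le_succ n)
      have hleN : κ (n + 1) ≤ m := hm ▸ hκ hn
      obtain ⟨c, hc⟩ := Nat.exists_eq_add_of_le hle
      have hs := h.shift (n := c) (κ n) (by omega)
      have hb := hs.bound (fun k => he _) (by
        refine le_trans ?_ he1
        have hsum : ∑ k ∈ Finset.range c, e (κ n + k) = ∑ k ∈ Finset.Ico (κ n) (κ (n + 1)), e k := by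
          rw [Finset.sum_Ico_eq_sum_range, hc]; simp
        rw [hsum]
        apply Finset.sum_le_sum_of_subset_of_nonneg
        · intro k hk; simp only [Finset.mem_Ico, Finset.mem_range] at *; omega
        · intro k _ _; exact he k) hε hC
        (fun k hk => hω n (by omega) (κ n + k) (by omega) (by omega))
      simp only [add_zero] at hb
      constructor
      · rw [hc, SV_shift, KB]
        have h1 : ‖X (κ n) - x₀‖ ≤ R + n * (ε / 7) + KB ε R n := by
          have h2 : X (κ n) - x₀ = ((X (κ n) - φ (κ n)) - (X 0 - φ 0)) + (φ (κ n) - φ 0)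
              + (X 0 - x₀) := by abel
          rw [h2]
          have h3 := norm_sub_le_SV_sub φ (Nat.zero_le (κ n))
          rw [SV_zero] at h3
          have h4 := norm_add₃_le (a := (X (κ n) - φ (κ n)) - (X 0 - φ 0))
            (b := φ (κ n) - φ 0) (c := X 0 - x₀)
          linarith
        have h2 : ‖X (κ n) - x₀‖ ^ 2 ≤ (R + n * (ε / 7) + KB ε R n) ^ 2 :=
          pow_le_pow_left₀ (norm_nonneg _) h1 2
        have h3 : 0 ≤ 2 / ε := by positivity
        have h4 := mul_le_mul_of_nonneg_left h2 h3
        linarith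
      · have h1 := hω n (by omega) (κ (n + 1)) hle le_rfl
        have h2 : (X (κ (n + 1)) - φ (κ (n + 1))) - (X 0 - φ 0) =
          ((X (κ (n + 1)) - φ (κ (n + 1))) - (X (κ n) - φ (κ n))) +
          ((X (κ n) - φ (κ n)) - (X 0 - φ 0)) := by abel
        rw [h2]
        push_cast
        linarith [norm_add_le ((X (κ (n + 1)) - φ (κ (n + 1))) - (X (κ n) - φ (κ n)))
          ((X (κ n) - φ (κ n)) - (X 0 - φ 0))]
  rw [← hm]
  exact (key N le_rfl).1

end DiscretePart

section ContinuousPart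

lemma scalar_cell {ν : Measure ℝ} {g : ℝ → ℝ} {a b ω : ℝ} (hν : ν (Ioc a b) < ⊤)
    (hg : IntegrableOn g (Ioc a b) ν) (hω : ∀ τ ∈ Ioc a b, |g τ - g b| ≤ ω) :
    |(∫ τ in Ioc a b, g τ ∂ν) - g b * (ν (Ioc a b)).toReal| ≤ ω * (ν (Ioc a b)).toReal := by
  have hc : IntegrableOn (fun _ : ℝ => g b) (Ioc a b) ν := integrableOn_const hν.ne
  have h1 : (∫ τ in Ioc a b, g τ ∂ν) - g b * (ν (Ioc a b)).toReal
      = ∫ τ in Ioc a b, (g τ - g b) ∂ν := by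
    rw [integral_sub hg hc, setIntegral_const, smul_eq_mul, mul_comm, measureReal_def]
  rw [h1]
  exact norm_setIntegral_le_of_norm_le_const (f := fun τ => g τ - g b) hν hω

variable {d : ℕ}

lemma abs_coord_le (x : Euc d) (i : Fin d) : |x i| ≤ ‖x‖ := by
  simpa using PiLp.norm_apply_le x i

namespace BVMeasureData

variable {φ : ℝ → Euc d} (M : BVMeasureData d φ)

/-- total mass of the measures. -/
def G (a b : ℝ) : ℝ := ∑ i : Fin d, ((M.pos i (Ioc a b)).toReal + (M.neg i (Ioc a b)).toReal)

lemma pos_lt {a b : ℝ} (ha : 0 ≤ a) (i : Fin d) : M.pos i (Ioc a b) < ⊤ :=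
  (measure_mono (show Ioc a b ⊆ Icc 0 b from fun _ hx => ⟨ha.trans hx.1.le, hx.2⟩)).trans_lt (M.pos_fin i b)

lemma neg_lt {a b : ℝ} (ha : 0 ≤ a) (i : Fin d) : M.neg i (Ioc a b) < ⊤ :=
  (measure_mono (show Ioc a b ⊆ Icc 0 b from fun _ hx => ⟨ha.trans hx.1.le, hx.2⟩)).trans_lt (M.neg_fin i b)

lemma G_nonneg (a b : ℝ) : 0 ≤ M.G a b := Finset.sum_nonneg fun _ _ => by positivity

lemma toReal_Ioc_add {ν : Measure ℝ} {a b c : ℝ} (hab : a ≤ b) (hbc : b ≤ c)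
    (h : ν (Ioc a c) < ⊤) :
    (ν (Ioc a c)).toReal = (ν (Ioc a b)).toReal + (ν (Ioc b c)).toReal := by
  have h1 : ν (Ioc a b) < ⊤ := (measure_mono (Ioc_subset_Ioc_right hbc)).trans_lt h
  have h2 : ν (Ioc b c) < ⊤ := (measure_mono (Ioc_subset_Ioc_left hab)).trans_lt h
  rw [← Ioc_union_Ioc_eq_Ioc hab hbc, measure_union (Ioc_disjoint_Ioc_of_le le_rfl)
    measurableSet_Ioc, ENNReal.toReal_add h1.ne h2.ne]

lemma G_add {a b c : ℝ} (ha : 0 ≤ a) (hab : a ≤ b) (hbc : b ≤ c) :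
    M.G a c = M.G a b + M.G b c := by
  unfold G
  rw [← Finset.sum_add_distrib]
  refine Finset.sum_congr rfl fun i _ => ?_
  rw [toReal_Ioc_add hab hbc (M.pos_lt ha i), toReal_Ioc_add hab hbc (M.neg_lt ha i)]
  ring

/-- integrability of the coordinates against the measures -/
def IntOn (f : ℝ → Euc d) (a b : ℝ) : Prop :=
  ∀ i, IntegrableOn (fun τ => f τ i) (Ioc a b) (M.pos i) ∧
    IntegrableOn (fun τ => f τ i) (Ioc a b) (M.neg i)

lemma pairing_add {f : ℝ → Euc d} {a b c : ℝ} (hab : a ≤ b) (hbc : b ≤ c)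
    (hf : M.IntOn f a c) : M.pairing f a c = M.pairing f a b + M.pairing f b c := by
  unfold pairing
  rw [← Finset.sum_add_distrib]
  refine Finset.sum_congr rfl fun i _ => ?_
  have s1 : Ioc a b ⊆ Ioc a c := Ioc_subset_Ioc_right hbc
  have s2 : Ioc b c ⊆ Ioc a c := Ioc_subset_Ioc_left hab
  rw [← Ioc_union_Ioc_eq_Ioc hab hbc, setIntegral_union (Ioc_disjoint_Ioc_of_le le_rfl)
    measurableSet_Ioc ((hf i).1.mono_set s1) ((hf i).1.mono_set s2),
    setIntegral_union (Ioc_disjoint_Ioc_of_le le_rfl)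
    measurableSet_Ioc ((hf i).2.mono_set s1) ((hf i).2.mono_set s2)]
  ring

lemma cell {f : ℝ → Euc d} {a b ω : ℝ} (ha : 0 ≤ a) (hab : a ≤ b) (hf : M.IntOn f a b)
    (hω : ∀ τ ∈ Ioc a b, ‖f τ - f b‖ ≤ ω) :
    |M.pairing f a b - inner ℝ (f b) (φ b - φ a)| ≤ ω * M.G a b := by
  have h1 : M.pairing f a b - inner ℝ (f b) (φ b - φ a) = ∑ i : Fin d,
      (((∫ τ in Ioc a b, f τ i ∂(M.pos i)) - f b i * (M.pos i (Ioc a b)).toReal)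
      - ((∫ τ in Ioc a b, f τ i ∂(M.neg i)) - f b i * (M.neg i (Ioc a b)).toReal)) := by
    unfold pairing
    rw [PiLp.inner_apply, ← Finset.sum_sub_distrib]
    refine Finset.sum_congr rfl fun i _ => ?_
    have := M.increments i a b ha hab
    simp only [PiLp.sub_apply, RCLike.inner_apply, conj_trivial]
    rw [← this]; ring
  rw [h1, G, Finset.mul_sum]
  refine (Finset.abs_sum_le_sum_abs _ _).trans (Finset.sum_le_sum fun i _ => ?_)
  have hi : ∀ τ ∈ Ioc a b, |f τ i - f b i| ≤ ω := fun τ hτ => by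
    have := abs_coord_le (f τ - f b) i
    simp only [PiLp.sub_apply] at this
    exact this.trans (hω τ hτ)
  have h2 := scalar_cell (M.pos_lt ha i) (hf i).1 hi
  have h3 := scalar_cell (M.neg_lt ha i) (hf i).2 hi
  refine (abs_sub _ _).trans ?_
  linarith

lemma intOn_cont {f : ℝ → Euc d} {a b : ℝ} (ha : 0 ≤ a)
    (hf : ContinuousOn f (Icc a b)) : M.IntOn f a b := by
  intro i
  have hc : ContinuousOn (fun τ => f τ i) (Icc a b) := by fun_prop
  obtain ⟨C, hC⟩ := isCompact_Icc.exists_bound_of_continuousOn hc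
  have gen : ∀ ν : Measure ℝ, ν (Ioc a b) < ⊤ → IntegrableOn (fun τ => f τ i) (Ioc a b) ν := by
    intro ν hν
    refine IntegrableOn.of_bound hν
      ((hc.mono Ioc_subset_Icc_self).aestronglyMeasurable measurableSet_Ioc) C ?_
    exact (ae_restrict_iff' measurableSet_Ioc).2 (ae_of_all _ fun x hx => hC x (Ioc_subset_Icc_self hx))
  exact ⟨gen _ (M.pos_lt ha i), gen _ (M.neg_lt ha i)⟩

lemma intOn_phi {a b : ℝ} (ha : 0 ≤ a) : M.IntOn φ a b := by
  intro i
  have mon : ∀ ν : Measure ℝ, ν (Ioc a b) < ⊤ →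
      MonotoneOn (fun τ => (ν (Ioc a τ)).toReal) (Ioc a b) := by
    intro ν hν x hx y hy hxy
    refine ENNReal.toReal_mono ?_ (measure_mono (Ioc_subset_Ioc_right hxy))
    exact ((measure_mono (Ioc_subset_Ioc_right hy.2)).trans_lt hν).ne
  have int1 : ∀ μ ν : Measure ℝ, μ (Ioc a b) < ⊤ → ν (Ioc a b) < ⊤ →
      IntegrableOn (fun τ => (ν (Ioc a τ)).toReal) (Ioc a b) μ := by
    intro μ ν hμ hν
    refine IntegrableOn.of_bound hμ
      (aemeasurable_restrict_of_monotoneOn measurableSet_Ioc (mon ν hν)).aestronglyMeasurable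
      (ν (Ioc a b)).toReal ?_
    refine (ae_restrict_iff' measurableSet_Ioc).2 (ae_of_all _ fun x hx => ?_)
    rw [Real.norm_of_nonneg ENNReal.toReal_nonneg]
    exact ENNReal.toReal_mono hν.ne (measure_mono (Ioc_subset_Ioc_right hx.2))
  have gen : ∀ μ : Measure ℝ, μ (Ioc a b) < ⊤ → IntegrableOn (fun τ => φ τ i) (Ioc a b) μ := by
    intro μ hμ
    have h1 := ((int1 μ _ hμ (M.pos_lt ha i)).sub (int1 μ _ hμ (M.neg_lt ha i))).add
      (integrableOn_const (C := φ a i) hμ.ne)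
    refine h1.congr_fun (fun τ hτ => ?_) measurableSet_Ioc
    have := M.increments i a τ ha hτ.1.le
    simp only [Pi.add_apply, Pi.sub_apply]
    linarith
  exact ⟨gen _ (M.pos_lt ha i), gen _ (M.neg_lt ha i)⟩

lemma IntOn.sub {f g : ℝ → Euc d} {a b : ℝ} (hf : M.IntOn f a b) (hg : M.IntOn g a b) :
    M.IntOn (fun τ => f τ - g τ) a b := fun i =>
  ⟨((hf i).1.sub (hg i).1), ((hf i).2.sub (hg i).2)⟩

lemma IntOn.add {f g : ℝ → Euc d} {a b : ℝ} (hf : M.IntOn f a b) (hg : M.IntOn g a b) :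
    M.IntOn (fun τ => f τ + g τ) a b := fun i =>
  ⟨((hf i).1.add (hg i).1), ((hf i).2.add (hg i).2)⟩

lemma IntOn.congr {f g : ℝ → Euc d} {a b : ℝ} (hf : M.IntOn f a b)
    (h : ∀ τ ∈ Ioc a b, f τ = g τ) : M.IntOn g a b := fun i =>
  ⟨(hf i).1.congr_fun (fun τ hτ => by simp only [h τ hτ]) measurableSet_Ioc,
   (hf i).2.congr_fun (fun τ hτ => by simp only [h τ hτ]) measurableSet_Ioc⟩

end BVMeasureData

lemma scalar_shrink {ν : Measure ℝ} {g : ℝ → ℝ} {t : ℝ} {s : ℕ → ℝ} (hs : Monotone s)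
    (hst : ∀ n, s n < t) (hlim : Tendsto s atTop (𝓝 t)) (hg : IntegrableOn g (Ioc (s 0) t) ν) :
    Tendsto (fun n => ∫ τ in Ioc (s n) t, g τ ∂ν) atTop (𝓝 (g t * ν.real {t})) := by
  have h := tendsto_setIntegral_of_antitone (μ := ν) (f := g) (s := fun n => Ioc (s n) t)
    (fun n => measurableSet_Ioc) (fun m n hmn => Ioc_subset_Ioc_left (hs hmn)) ⟨0, hg⟩
  have h2 : ⋂ n, Ioc (s n) t = {t} := by
    ext x
    simp only [mem_iInter, mem_Ioc, mem_singleton_iff]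
    constructor
    · intro hx
      exact le_antisymm (hx 0).2 (le_of_tendsto hlim (Eventually.of_forall fun n => (hx n).1.le))
    · rintro rfl n; exact ⟨hst n, le_rfl⟩
  rw [h2, integral_singleton, smul_eq_mul, mul_comm] at h
  exact h

namespace IsSkorohodSolution

variable {D : Set (Euc d)} {w X φ : ℝ → Euc d} {M : BVMeasureData d φ}

lemma intOn_X (h : IsSkorohodSolution D w X φ M) (hw : ContinuousOn w (Ici 0)) {a b : ℝ}
    (ha : 0 ≤ a) : M.IntOn X a b := by
  have h1 := M.intOn_cont (b := b) ha (hw.mono (fun x hx => ha.trans hx.1))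
  refine (h1.add M (M.intOn_phi ha)).congr M fun τ hτ => ?_
  exact (h.eqn τ (ha.trans hτ.1.le)).symm

lemma left_lim (h : IsSkorohodSolution D w X φ M) (hw : ContinuousOn w (Ici 0)) {t : ℝ}
    (ht : 0 < t) : Tendsto X (𝓝[<] t) (𝓝 (X t)) := by
  obtain ⟨L, hL⟩ := h.leftLim t ht
  obtain ⟨s, hsm, hst, hs⟩ := exists_seq_strictMono_tendsto' ht
  have hs' : Tendsto s atTop (𝓝[<] t) :=
    tendsto_nhdsWithin_iff.2 ⟨hs, Eventually.of_forall fun n => (hst n).2⟩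
  have hLC : L ∈ closure D := by
    refine isClosed_closure.mem_of_tendsto (hL.comp hs') (Eventually.of_forall fun n => ?_)
    exact h.mem _ (hst n).1.le
  have hwt : Tendsto (fun n => w (s n)) atTop (𝓝 (w t)) := by
    have := (hw t ht.le).tendsto
    exact this.comp (tendsto_nhdsWithin_iff.2 ⟨hs, Eventually.of_forall fun n => (hst n).1.le⟩)
  have hφ : Tendsto (fun n => φ (s n)) atTop (𝓝 (L - w t)) := by
    refine ((hL.comp hs').sub hwt).congr fun n => ?_
    simp [h.eqn _ (hst n).1.le]
  have hφt : φ t - (L - w t) = X t - L := by rw [h.eqn t ht.le]; abel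
  have hnn : ∀ n, 0 ≤ M.pairing (fun τ => L - X τ) (s n) t := fun n =>
    h.assoc.normal (fun _ => L) continuous_const (fun _ _ => hLC) _ _ (hst n).1.le (hst n).2.le
  have hIntg := (M.intOn_cont (f := fun _ => L) (b := t) (hst 0).1.le continuousOn_const).sub M
    (h.intOn_X hw (b := t) (hst 0).1.le)
  have one : ∀ (ν : Measure ℝ), ν (Ioc (s 0) t) < ⊤ →
      Tendsto (fun n => (ν (Ioc (s n) t)).toReal) atTop (𝓝 (ν.real {t})) := by
    intro ν hν
    have := scalar_shrink (g := fun _ => 1) hsm.monotone (fun n => (hst n).2) hs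
      (integrableOn_const (C := (1:ℝ)) hν.ne)
    simpa [setIntegral_const, measureReal_def] using this
  have hjump : ∀ i, (M.pos i).real {t} - (M.neg i).real {t} = X t i - L i := by
    intro i
    have h1 := (one _ (M.pos_lt (hst 0).1.le i)).sub (one _ (M.neg_lt (hst 0).1.le i))
    have h2 : Tendsto (fun n => (φ t - φ (s n)) i) atTop (𝓝 ((φ t - (L - w t)) i)) := by
      have : Continuous fun x : Euc d => (φ t - x) i := by fun_prop
      exact (this.tendsto _).comp hφ
    rw [hφt] at h2
    refine tendsto_nhds_unique h1 (h2.congr fun n => ?_)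
    rw [M.increments i _ _ (hst n).1.le (hst n).2.le]; simp
  have hlim : Tendsto (fun n => M.pairing (fun τ => L - X τ) (s n) t) atTop
      (𝓝 (∑ i : Fin d, ((L - X t) i * (M.pos i).real {t} - (L - X t) i * (M.neg i).real {t}))) := by
    unfold BVMeasureData.pairing
    refine tendsto_finsetSum _ fun i _ => ?_
    exact (scalar_shrink hsm.monotone (fun n => (hst n).2) hs (hIntg i).1).sub
      (scalar_shrink hsm.monotone (fun n => (hst n).2) hs (hIntg i).2)
  have h0 := ge_of_tendsto' hlim hnn
  have h1 : ∑ i : Fin d, ((L - X t) i * (M.pos i).real {t} - (L - X t) i * (M.neg i).real {t})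
      = - ‖L - X t‖ ^ 2 := by
    rw [EuclideanSpace.real_norm_sq_eq, ← Finset.sum_neg_distrib]
    refine Finset.sum_congr rfl fun i _ => ?_
    rw [← mul_sub, hjump i]; simp only [PiLp.sub_apply]; ring
  rw [h1] at h0
  have h2 : ‖L - X t‖ = 0 := by
    have := sq_nonneg ‖L - X t‖
    exact pow_eq_zero_iff (two_ne_zero) |>.1 (by linarith)
  rw [norm_eq_zero, sub_eq_zero] at h2
  rwa [h2] at hL

lemma continuousOn (h : IsSkorohodSolution D w X φ M) (hw : ContinuousOn w (Ici 0)) :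
    ContinuousOn X (Ici 0) := by
  intro t ht
  rcases eq_or_lt_of_le (show (0:ℝ) ≤ t from ht) with rfl | ht'
  · exact h.rightCont 0 le_rfl
  · apply ContinuousAt.continuousWithinAt
    rw [continuousAt_iff_continuous_left'_right']
    exact ⟨h.left_lim hw ht', (h.rightCont t ht'.le).mono Ioi_subset_Ici_self⟩

/-- the grid -/
lemma dsol (h : IsSkorohodSolution D w X φ M) (hw : ContinuousOn w (Ici 0)) {r : ℕ → ℝ}
    (hr : Monotone r) (hr0 : 0 ≤ r 0) {m : ℕ} {ω : ℝ}
    (hω : ∀ k < m, ∀ τ ∈ Icc (r k) (r (k + 1)), ‖X τ - X (r (k + 1))‖ ≤ ω) :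
    DSol (closure D) (fun k => ω * M.G (r k) (r (k + 1))) (fun k => X (r k)) (fun k => φ (r k)) m := by
  have hk0 : ∀ k, 0 ≤ r k := fun k => hr0.trans (hr (Nat.zero_le k))
  refine ⟨fun k _ => h.mem _ (hk0 k), fun k hk y hy => ?_⟩
  have hle : r k ≤ r (k + 1) := hr (Nat.le_succ k)
  have h1 := h.assoc.normal (fun _ => y) continuous_const (fun _ _ => hy) _ _ (hk0 k) hle
  have h2 := M.cell (f := fun τ => y - X τ) (hk0 k) hle
    ((M.intOn_cont (f := fun _ => y) (hk0 k) continuousOn_const).sub M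
    (h.intOn_X hw (hk0 k))) (ω := ω) (fun τ hτ => by
      rw [sub_sub_sub_cancel_left, norm_sub_rev]
      exact hω k hk τ (Ioc_subset_Icc_self hτ))
  rw [abs_le] at h2
  linarith [h2.2]

end IsSkorohodSolution

lemma G_sum {φ : ℝ → Euc d} (M : BVMeasureData d φ) {r : ℕ → ℝ}
    (hr : Monotone r) (hr0 : 0 ≤ r 0) (m : ℕ) :
    ∑ k ∈ Finset.range m, M.G (r k) (r (k + 1)) = M.G (r 0) (r m) := by
  induction m with
  | zero => simp [BVMeasureData.G]
  | succ m ih =>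
    rw [Finset.sum_range_succ, ih, ← M.G_add hr0 (hr (Nat.zero_le m)) (hr (Nat.le_succ m))]

end ContinuousPart

section Compare

variable {d : ℕ}

lemma IsSkorohodSolution.grid {D : Set (Euc d)} {w X φ : ℝ → Euc d} {M : BVMeasureData d φ}
    (h : IsSkorohodSolution D w X φ M) (hw : ContinuousOn w (Ici 0))
    {x₀ : Euc d} {ε R : ℝ} (hε : 0 < ε) (hC : Metric.closedBall x₀ ε ⊆ closure D)
    (hR : ‖X 0 - x₀‖ ≤ R) {T : ℝ} {N : ℕ} (hN : 0 < N)
    (hosc : ∀ s ∈ Icc 0 T, ∀ t ∈ Icc 0 T, |s - t| ≤ T / N → ‖w s - w t‖ ≤ ε / 7)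
    {t : ℝ} (ht : t ∈ Icc 0 T) {ρ : ℝ} (hρ : 0 < ρ) (hρ1 : ρ ≤ 1) :
    ∃ n₀ : ℕ, ∀ n : ℕ, n₀ ≤ n → 0 < n → ∃ e : ℕ → ℝ,
      ∑ k ∈ Finset.range (N * n), e k ≤ ρ ∧
      DSol (closure D) e (fun k : ℕ => X (k * (t / (N * n)))) (fun k : ℕ => φ (k * (t / (N * n))))
        (N * n) ∧
      SV (fun k : ℕ => φ (k * (t / (N * n)))) (N * n) ≤ KB ε R N := by
  have hcX : ContinuousOn X (Icc 0 t) := (h.continuousOn hw).mono fun x hx => hx.1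
  have huc := isCompact_Icc.uniformContinuousOn_of_continuous hcX
  have hG := M.G_nonneg 0 t
  set ω := ρ / (M.G 0 t + 1) with hω
  have hω0 : 0 < ω := by positivity
  obtain ⟨δ, hδ, hδX⟩ := Metric.uniformContinuousOn_iff.1 huc ω hω0
  obtain ⟨n₀, hn₀⟩ := exists_nat_gt (t / δ)
  refine ⟨n₀, fun n hn hn0 => ?_⟩
  have hNR : (1:ℝ) ≤ N := by exact_mod_cast hN
  have hnR : (1:ℝ) ≤ n := by exact_mod_cast hn0
  have ht0 : 0 ≤ t := ht.1
  set c := t / (N * n) with hc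
  have hc0 : 0 ≤ c := by positivity
  have hNc : (N * n : ℝ) * c = t := by rw [hc]; field_simp
  have hnc : (n : ℝ) * c = t / N := by rw [hc]; field_simp
  have hcδ : c < δ := by
    have h1 : t / δ < n := hn₀.trans_le (by exact_mod_cast hn)
    rw [div_lt_iff₀ hδ] at h1
    have h2 : (n:ℝ) * c ≤ t := by
      rw [hnc]; exact div_le_self ht0 hNR
    nlinarith
  set r : ℕ → ℝ := fun k => k * c with hr
  have hrm : Monotone r := fun a b hab => by
    simp only [hr]
    have : (a:ℝ) ≤ b := by exact_mod_cast hab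
    exact mul_le_mul_of_nonneg_right this hc0
  have hr0 : r 0 = 0 := by simp [hr]
  have hrN : r (N * n) = t := by simp only [hr]; push_cast; exact hNc
  have hrmem : ∀ k ≤ N * n, r k ∈ Icc 0 t := fun k hk => ⟨by simp only [hr]; positivity, hrN ▸ hrm hk⟩
  have hds := h.dsol hw (m := N * n) (ω := ω) hrm hr0.ge (fun k hk τ hτ => by
    have h1 := hrmem k hk.le
    have h2 := hrmem (k + 1) hk
    have h3 : r (k + 1) = r k + c := by simp only [hr]; push_cast; ring
    have := hδX τ ⟨h1.1.trans hτ.1, hτ.2.trans h2.2⟩ (r (k + 1)) h2 (by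
      rw [Real.dist_eq, abs_lt]; constructor <;> linarith [hτ.1, hτ.2])
    rw [dist_eq_norm] at this
    exact this.le)
  have hsum : ∑ k ∈ Finset.range (N * n), ω * M.G (r k) (r (k + 1)) ≤ ρ := by
    rw [← Finset.mul_sum, G_sum M hrm hr0.ge, hr0, hrN, hω, div_mul_eq_mul_div,
      div_le_iff₀ (by positivity)]
    nlinarith
  refine ⟨_, hsum, hds, ?_⟩
  refine hds.chain (κ := fun j => j * n) (fun a b hab => Nat.mul_le_mul_right n hab) (by simp) rfl
    (fun k => mul_nonneg hω0.le (M.G_nonneg _ _)) (hsum.trans hρ1) hε hC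
    (by simpa [hr0] using hR) ?_
  intro j hj k hk1 hk2
  have hkN : (j + 1) * n ≤ N * n := Nat.mul_le_mul_right n hj
  have m1 := hrmem k (hk2.trans hkN)
  have m2 := hrmem (j * n) (hk1.trans (hk2.trans hkN))
  have e1 : ∀ s ∈ Icc 0 t, X s - φ s = w s := fun s hs => by rw [h.eqn s hs.1]; abel
  show ‖(X (r k) - φ (r k)) - (X (r (j * n)) - φ (r (j * n)))‖ ≤ ε / 7
  rw [e1 _ m1, e1 _ m2]
  refine hosc _ ⟨m1.1, m1.2.trans ht.2⟩ _ ⟨m2.1, m2.2.trans ht.2⟩ ?_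
  have a1 : r (j * n) ≤ r k := hrm hk1
  have a2 : r k ≤ r ((j + 1) * n) := hrm hk2
  have a3 : r ((j + 1) * n) = r (j * n) + n * c := by simp only [hr]; push_cast; ring
  have a4 : t / N ≤ T / N := by gcongr; exact ht.2
  rw [abs_of_nonneg (by linarith)]
  linarith

lemma sol_compare {D : Set (Euc d)} {w X φ : ℝ → Euc d} {M : BVMeasureData d φ}
    (h : IsSkorohodSolution D w X φ M) (hw : ContinuousOn w (Ici 0))
    {w' X' φ' : ℝ → Euc d} {M' : BVMeasureData d φ'}
    (h' : IsSkorohodSolution D w' X' φ' M') (hw' : ContinuousOn w' (Ici 0))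
    {x₀ : Euc d} {ε R : ℝ} (hε : 0 < ε) (hC : Metric.closedBall x₀ ε ⊆ closure D)
    (hR : ‖X 0 - x₀‖ ≤ R) (hR' : ‖X' 0 - x₀‖ ≤ R) {T : ℝ} {N : ℕ} (hN : 0 < N)
    (hosc : ∀ s ∈ Icc 0 T, ∀ t ∈ Icc 0 T, |s - t| ≤ T / N → ‖w s - w t‖ ≤ ε / 7)
    (hosc' : ∀ s ∈ Icc 0 T, ∀ t ∈ Icc 0 T, |s - t| ≤ T / N → ‖w' s - w' t‖ ≤ ε / 7)
    {ω : ℝ} (hω : ∀ t ∈ Icc 0 T, ‖w t - w' t‖ ≤ ω)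
    {t : ℝ} (ht : t ∈ Icc 0 T) :
    ‖φ t - φ' t‖ ^ 2 ≤ 4 * ω * KB ε R N := by
  have main : ∀ ρ : ℝ, 0 < ρ → ρ ≤ 1 → ‖φ t - φ' t‖ ^ 2 ≤ 4 * ω * KB ε R N + 4 * ρ := by
    intro ρ hρ hρ1
    obtain ⟨n₁, h1⟩ := h.grid hw hε hC hR hN hosc ht hρ hρ1
    obtain ⟨n₂, h2⟩ := h'.grid hw' hε hC hR' hN hosc' ht hρ hρ1
    set n := n₁ + n₂ + 1
    obtain ⟨e, he, hd, hv⟩ := h1 n (by omega) (by omega)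
    obtain ⟨e', he', hd', hv'⟩ := h2 n (by omega) (by omega)
    have hNR : (1:ℝ) ≤ N := by exact_mod_cast hN
    have hnR : (1:ℝ) ≤ n := by exact_mod_cast (show 1 ≤ n by omega)
    have ht0 : 0 ≤ t := ht.1
    have hω0 : 0 ≤ ω := (norm_nonneg _).trans (hω t ht)
    have hk := hd.key hd' ω (fun k hk => by
      have hm : (k * (t / (N * n)) : ℝ) ∈ Icc 0 T := by
        refine ⟨by positivity, le_trans ?_ ht.2⟩
        have : (k:ℝ) ≤ N * n := by exact_mod_cast hk
        rw [mul_div_assoc', div_le_iff₀ (by positivity)]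
        nlinarith
      have := hω _ hm
      rw [h.eqn _ hm.1, h'.eqn _ hm.1]
      simpa using this)
    have hend : ((N * n : ℕ) : ℝ) * (t / (N * n)) = t := by push_cast; field_simp
    simp only [hend, Nat.cast_zero, zero_mul, h.assoc.init, h'.assoc.init, sub_self, norm_zero,
      Finset.sum_add_distrib] at hk
    have := mul_le_mul_of_nonneg_left (add_le_add hv hv') hω0
    nlinarith
  refine le_of_forall_pos_le_add fun η hη => ?_
  have := main (min (η / 4) 1) (by positivity) (min_le_right _ _)
  linarith [min_le_left (η / 4) 1]

lemma exists_ball {D : Set (Euc d)} (hne : D.Nonempty) (hopen : IsOpen D) :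
    ∃ (x₀ : Euc d) (ε : ℝ), 0 < ε ∧ Metric.closedBall x₀ ε ⊆ closure D := by
  obtain ⟨x, hx⟩ := hne
  obtain ⟨ε, hε, hb⟩ := Metric.nhds_basis_closedBall.mem_iff.1 (hopen.mem_nhds hx)
  exact ⟨x, ε, hε, hb.trans subset_closure⟩

lemma exists_blocks {w : ℝ → Euc d} (hw : ContinuousOn w (Ici 0)) {T η : ℝ} (hη : 0 < η) :
    ∃ N : ℕ, 0 < N ∧
      ∀ s ∈ Icc 0 T, ∀ t ∈ Icc 0 T, |s - t| ≤ T / N → ‖w s - w t‖ ≤ η := by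
  have hc : ContinuousOn w (Icc 0 T) := hw.mono fun x hx => hx.1
  have huc := isCompact_Icc.uniformContinuousOn_of_continuous hc
  obtain ⟨δ, hδ, hδX⟩ := Metric.uniformContinuousOn_iff.1 huc η hη
  obtain ⟨n₀, hn₀⟩ := exists_nat_gt (T / δ)
  refine ⟨n₀ + 1, Nat.succ_pos _, fun s hs t ht hst => ?_⟩
  have h1 : T / ((n₀ + 1 : ℕ) : ℝ) < δ := by
    rw [div_lt_iff₀ hδ] at hn₀
    rw [div_lt_iff₀ (by positivity)]
    push_cast; linarith
  have := hδX s hs t ht (by rw [Real.dist_eq]; linarith)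
  rw [dist_eq_norm] at this
  exact this.le

lemma skor_unique {D : Set (Euc d)} (hne : D.Nonempty) (hopen : IsOpen D)
    {w X φ : ℝ → Euc d} {M : BVMeasureData d φ}
    (h : IsSkorohodSolution D w X φ M) (hw : ContinuousOn w (Ici 0))
    {X' φ' : ℝ → Euc d} {M' : BVMeasureData d φ'}
    (h' : IsSkorohodSolution D w X' φ' M') (t : ℝ) (ht : 0 ≤ t) : X t = X' t ∧ φ t = φ' t := by
  obtain ⟨x₀, ε, hε, hb⟩ := exists_ball hne hopen
  obtain ⟨N, hN, hosc⟩ := exists_blocks hw (T := t) (η := ε / 7) (by positivity)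
  have h1 := sol_compare h hw h' hw hε hb (le_max_left _ _) (le_max_right ‖X 0 - x₀‖ _) hN hosc hosc
    (ω := 0) (by simp) ⟨ht, le_rfl⟩
  have h2 : φ t = φ' t := by
    rw [mul_zero, zero_mul] at h1
    have : ‖φ t - φ' t‖ = 0 := pow_eq_zero_iff (two_ne_zero) |>.1 (le_antisymm h1 (sq_nonneg _))
    rwa [norm_eq_zero, sub_eq_zero] at this
  exact ⟨by rw [h.eqn t ht, h'.eqn t ht, h2], h2⟩

lemma skor_cont {D : Set (Euc d)} (hne : D.Nonempty) (hopen : IsOpen D)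
    (wseq : ℕ → ℝ → Euc d) (w : ℝ → Euc d)
        (Xseq : ℕ → ℝ → Euc d) (φseq : ℕ → ℝ → Euc d)
        (Mseq : ∀ n : ℕ, BVMeasureData d (φseq n))
        (X φ : ℝ → Euc d) (M : BVMeasureData d φ)
      (hwn : ∀ n, ContinuousOn (wseq n) (Ici 0))
      (hn : ∀ n, IsSkorohodSolution D (wseq n) (Xseq n) (φseq n) (Mseq n))
      (hw : ContinuousOn w (Ici 0))
      (h : IsSkorohodSolution D w X φ M)
      (T : ℝ) (hT : 0 < T) (hu : TendstoUniformlyOn wseq w atTop (Icc 0 T)) :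
      TendstoUniformlyOn Xseq X atTop (Icc 0 T) := by
  obtain ⟨x₀, ε, hε, hb⟩ := exists_ball hne hopen
  obtain ⟨N, hN, hosc⟩ := exists_blocks hw (T := T) (η := ε / 21) (by positivity)
  set R := ‖X 0 - x₀‖ + 1 with hR
  have hK := KB_nonneg (R := R) hε N
  rw [Metric.tendstoUniformlyOn_iff] at hu ⊢
  intro η hη
  set K := KB ε R N
  set ω := min (min (ε / 21) 1) (min (η / 4) (η ^ 2 / (16 * (K + 1)))) with hω
  have hω0 : 0 < ω := by positivity
  have w1 : ω ≤ ε / 21 := (min_le_left _ _).trans (min_le_left _ _)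
  have w2 : ω ≤ 1 := (min_le_left _ _).trans (min_le_right _ _)
  have w3 : ω ≤ η / 4 := (min_le_right _ _).trans (min_le_left _ _)
  have w4 : ω ≤ η ^ 2 / (16 * (K + 1)) := (min_le_right _ _).trans (min_le_right _ _)
  filter_upwards [hu ω hω0] with n hd t ht
  have hd' : ∀ t ∈ Icc 0 T, ‖w t - wseq n t‖ ≤ ω := fun t ht => by
    have := hd t ht
    rw [dist_eq_norm] at this
    exact this.le
  have h0 : ∀ {w X φ : ℝ → Euc d} {M : BVMeasureData d φ}, IsSkorohodSolution D w X φ M →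
    X 0 = w 0 := fun h => by rw [h.eqn 0 le_rfl, h.assoc.init, add_zero]
  have hR' : ‖Xseq n 0 - x₀‖ ≤ R := by
    have h1 := hd' 0 ⟨le_rfl, hT.le⟩
    rw [← h0 h, ← h0 (hn n), norm_sub_rev] at h1
    have h2 : Xseq n 0 - x₀ = (Xseq n 0 - X 0) + (X 0 - x₀) := by abel
    rw [h2]
    linarith [norm_add_le (Xseq n 0 - X 0) (X 0 - x₀)]
  have h1 := sol_compare h hw (hn n) (hwn n) hε hb (R := R) (by linarith) hR' hN
    (fun s hs t ht hst => (hosc s hs t ht hst).trans (by linarith))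
    (fun s hs t ht hst => by
      have a1 := hosc s hs t ht hst
      have a2 := hd' s hs
      have a3 := hd' t ht
      have a4 : wseq n s - wseq n t = (w s - w t) - (w s - wseq n s) + (w t - wseq n t) := by abel
      rw [a4]
      linarith [norm_add_le ((w s - w t) - (w s - wseq n s)) (w t - wseq n t),
        norm_sub_le (w s - w t) (w s - wseq n s)]) hd' ht
  have h2 : ‖φ t - φseq n t‖ ≤ η / 2 := by
    apply le_of_sq_le_sq _ (by positivity)
    rw [le_div_iff₀ (by positivity)] at w4
    have : ω * K ≤ ω * (K + 1) := by nlinarith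
    nlinarith
  have h3 := hd' t ht
  rw [dist_eq_norm, h.eqn t ht.1, (hn n).eqn t ht.1]
  have h4 : w t + φ t - (wseq n t + φseq n t) = (w t - wseq n t) + (φ t - φseq n t) := by abel
  rw [h4]
  linarith [norm_add_le (w t - wseq n t) (φ t - φseq n t)]

end Compare


section Scheme

variable {E : Type*} [NormedAddCommGroup E] [InnerProductSpace ℝ E]

/-- Discrete (projected Euler) scheme on the dyadic grids. -/
structure Scheme (C : Set E) (W : ℝ → E) (x p : ℕ → ℕ → E) : Prop where
  mem : ∀ n k, x n k ∈ C
  nrm : ∀ n k, ∀ y ∈ C, 0 ≤ inner ℝ (y - x n (k + 1)) (p n (k + 1) - p n k)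
  eqn : ∀ n k, x n k - p n k = W (k / 2 ^ n)
  p0 : ∀ n, p n 0 = 0

/-- The projected Euler scheme. -/
def eulerX (P : E → E) (W : ℝ → E) (n : ℕ) : ℕ → E
  | 0 => W 0
  | k + 1 => P (eulerX P W n k + (W ((k + 1 : ℕ) / 2 ^ n) - W (k / 2 ^ n)))

lemma exists_scheme [CompleteSpace E] {C : Set E} (hC : IsClosed C) (hconv : Convex ℝ C)
    {W : ℝ → E} (hW : W 0 ∈ C) : ∃ x p, Scheme C W x p := by
  have hP : ∀ u : E, ∃ v ∈ C, ∀ y ∈ C, inner ℝ (u - v) (y - v) ≤ 0 := by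
    intro u
    obtain ⟨v, hv, h⟩ := exists_norm_eq_iInf_of_complete_convex ⟨_, hW⟩ hC.isComplete hconv u
    exact ⟨v, hv, (norm_eq_iInf_iff_real_inner_le_zero hconv hv).1 h⟩
  choose P hPm hPi using hP
  refine ⟨eulerX P W, fun n k => eulerX P W n k - W (k / 2 ^ n), ?_, ?_, ?_, ?_⟩
  · intro n k
    cases k with
    | zero => exact hW
    | succ k => exact hPm _
  · intro n k y hy
    have h := hPi (eulerX P W n k + (W ((k + 1 : ℕ) / 2 ^ n) - W (k / 2 ^ n))) y hy
    have e1 : eulerX P W n (k + 1) = P (eulerX P W n k + (W ((k + 1 : ℕ) / 2 ^ n) - W (k / 2 ^ n))) :=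
      rfl
    rw [← e1] at h
    have e2 : (eulerX P W n (k + 1) - W ((k + 1 : ℕ) / 2 ^ n)) - (eulerX P W n k - W (k / 2 ^ n))
      = - (eulerX P W n k + (W ((k + 1 : ℕ) / 2 ^ n) - W (k / 2 ^ n)) - eulerX P W n (k + 1)) := by
      abel
    rw [e2, inner_neg_right, real_inner_comm]
    linarith
  · intro n k; simp
  · intro n; simp [eulerX]

variable {C : Set E} {W : ℝ → E} {x p : ℕ → ℕ → E}

lemma Scheme.dsol (h : Scheme C W x p) (n m : ℕ) : DSol C (fun _ => 0) (x n) (p n) m :=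
  ⟨fun k _ => h.mem n k, fun k _ y hy => by simpa using h.nrm n k y hy⟩

lemma div_succ_cases (k q : ℕ) : (k + 1) / q = k / q ∨ (k + 1) / q = k / q + 1 := by
  rw [Nat.succ_div]; split_ifs <;> simp

lemma Scheme.dsol_refine (h : Scheme C W x p) (n m q : ℕ) :
    DSol C (fun _ => 0) (fun k => x n (k / q)) (fun k => p n (k / q)) m := by
  refine ⟨fun k _ => h.mem n _, fun k _ y hy => ?_⟩
  rcases div_succ_cases k q with e | e
  · simp [e]
  · rw [e]; simpa using h.nrm n _ y hy

lemma SV_refine (f : ℕ → E) (q k : ℕ) : SV (fun k => f (k / q)) k = SV f (k / q) := by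
  induction k with
  | zero => simp [SV_zero]
  | succ k ih =>
    rw [SV_succ, ih]
    rcases div_succ_cases k q with e | e
    · simp [e]
    · rw [e, SV_succ]

/-- A vector with nonnegative product with all directions at an interior point vanishes. -/
lemma Scheme.interior_zero (h : Scheme C W x p) {n k : ℕ} {ε : ℝ} (hε : 0 < ε)
    (hb : Metric.closedBall (x n (k + 1)) ε ⊆ C) : p n (k + 1) = p n k := by
  have := ball_inner (e := 0) hε hb (fun y hy => by simpa using h.nrm n k y hy) le_rfl
  simp only [sub_self, inner_zero_left, add_zero] at this
  have h2 : ‖p n (k + 1) - p n k‖ ≤ 0 := by nlinarith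
  exact sub_eq_zero.1 (norm_le_zero_iff.1 h2)

/-- Modulus of continuity at dyadic scales. -/
def DMod (W : ℝ → E) : Prop :=
  ∀ T : ℕ, ∀ η : ℝ, 0 < η → ∃ q : ℕ, ∀ s ∈ Icc (0:ℝ) T, ∀ t ∈ Icc (0:ℝ) T,
    |s - t| ≤ 1 / 2 ^ q → ‖W s - W t‖ ≤ η

lemma dmod_of_continuous (hW : Continuous W) : DMod W := by
  intro T η hη
  have huc := (isCompact_Icc (a := (0:ℝ)) (b := T)).uniformContinuousOn_of_continuous hW.continuousOn
  obtain ⟨δ, hδ, h⟩ := Metric.uniformContinuousOn_iff.1 huc η hη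
  obtain ⟨q, hq⟩ := exists_pow_lt_of_lt_one hδ (show (1/2:ℝ) < 1 by norm_num)
  refine ⟨q, fun s hs t ht hst => ?_⟩
  have := h s hs t ht (by
    rw [Real.dist_eq]; refine hst.trans_lt ?_; rwa [one_div_pow] at hq)
  rw [dist_eq_norm] at this
  exact this.le

lemma grid_mem {T n k : ℕ} (hk : k ≤ T * 2 ^ n) : ((k:ℝ) / 2 ^ n) ∈ Icc (0:ℝ) T := by
  refine ⟨by positivity, ?_⟩
  rw [div_le_iff₀ (by positivity)]
  exact_mod_cast hk

lemma Scheme.bdd (h : Scheme C W x p) (hW : DMod W) {x₀ : E} {ε : ℝ} (hε : 0 < ε)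
    (hC : Metric.closedBall x₀ ε ⊆ C) (T : ℕ) :
    ∃ K : ℝ, 0 ≤ K ∧ ∃ q : ℕ, ∀ n ≥ q, SV (p n) (T * 2 ^ n) ≤ K := by
  obtain ⟨q, hq⟩ := hW T (ε / 7) (by positivity)
  refine ⟨KB ε ‖W 0 - x₀‖ (T * 2 ^ q), KB_nonneg hε _, q, fun n hn => ?_⟩
  have hx0 : x n 0 = W 0 := by
    have := h.eqn n 0
    rw [h.p0] at this; simpa using this
  have e0 : 2 ^ n = 2 ^ q * 2 ^ (n - q) := by rw [← pow_add]; congr 1; omega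
  refine (h.dsol n (T * 2 ^ n)).chain (κ := fun j => j * 2 ^ (n - q))
    (fun a b hab => Nat.mul_le_mul_right _ hab) (by simp) (by simp only [e0]; ring)
    (fun _ => le_rfl) (by simp) hε hC (by rw [hx0]) ?_
  intro j hj k hk1 hk2
  have hkT : k ≤ T * 2 ^ n := by
    refine hk2.trans ?_
    rw [e0, ← mul_assoc]
    exact Nat.mul_le_mul_right _ hj
  rw [h.eqn, h.eqn]
  refine hq _ (grid_mem hkT) _ (grid_mem (hk1.trans hkT)) ?_
  have h1 : ((j * 2 ^ (n - q) : ℕ) : ℝ) ≤ k := by exact_mod_cast hk1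
  have h2 : (k : ℝ) ≤ (((j + 1) * 2 ^ (n - q) : ℕ) : ℝ) := by exact_mod_cast hk2
  have e1 : (2:ℝ) ^ n = 2 ^ q * 2 ^ (n - q) := by exact_mod_cast e0
  rw [← sub_div, abs_of_nonneg (div_nonneg (by linarith) (by positivity)),
    div_le_div_iff₀ (by positivity) (by positivity), e1]
  push_cast at h1 h2 ⊢
  have h3 : (0:ℝ) < 2 ^ q := by positivity
  nlinarith

lemma Scheme.equi (h : Scheme C W x p) (hW : DMod W) {T q : ℕ} {K : ℝ} (hK0 : 0 ≤ K)
    (hK : ∀ n ≥ q, SV (p n) (T * 2 ^ n) ≤ K) {η : ℝ} (hη : 0 < η) :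
    ∃ r : ℕ, ∀ n ≥ r, ∀ a b : ℕ, a ≤ b → b ≤ T * 2 ^ n → ((b:ℝ) - a) / 2 ^ n ≤ 1 / 2 ^ r →
      ‖p n b - p n a‖ ≤ η ∧ ‖x n b - x n a‖ ≤ 2 * η := by
  set ω := min η (η ^ 2 / (2 * (K + 1))) with hω
  have hω0 : 0 < ω := by positivity
  obtain ⟨r, hr⟩ := hW T ω hω0
  refine ⟨max q r, fun n hn a b hab hb hd => ?_⟩
  have hn1 : q ≤ n := (le_max_left _ _).trans hn
  have hW1 : ∀ k, a ≤ k → k ≤ b → ‖W (k / 2 ^ n) - W (a / 2 ^ n)‖ ≤ ω := by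
    intro k hk1 hk2
    refine hr _ (grid_mem (hk2.trans hb)) _ (grid_mem (hab.trans hb)) ?_
    have h1 : (a:ℝ) ≤ k := by exact_mod_cast hk1
    have h2 : (k:ℝ) ≤ b := by exact_mod_cast hk2
    rw [← sub_div, abs_of_nonneg (div_nonneg (by linarith) (by positivity))]
    have h3 : ((k:ℝ) - a) / 2 ^ n ≤ ((b:ℝ) - a) / 2 ^ n := by gcongr
    refine h3.trans (hd.trans ?_)
    exact one_div_le_one_div_of_le (by positivity)
      (pow_le_pow_right₀ (by norm_num) (le_max_right _ _))
  obtain ⟨c, rfl⟩ := Nat.exists_eq_add_of_le hab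
  have key := DSol.key ((h.dsol n (a + c)).shift a le_rfl) (DSol.const (h.mem n a) (p n a) c) ω
    (fun k hk => by
      rw [h.eqn, h.eqn]; exact hW1 _ (by omega) (by omega))
  have hs1 : SV (fun k => p n (a + k)) c ≤ K := by
    have := SV_shift (p n) a c
    have := SV_nonneg (p n) a
    have := SV_mono (p n) hb
    linarith [hK n hn1]
  have hs2 : SV (fun _ : ℕ => p n a) c = 0 := by simp [SV]
  rw [hs2] at key
  simp only [add_zero, sub_self, norm_zero, Finset.sum_const_zero, mul_zero] at key
  have h4 : 2 * ω * (K + 1) ≤ η ^ 2 := by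
    have := min_le_right η (η ^ 2 / (2 * (K + 1)))
    rw [← hω, le_div_iff₀ (by positivity)] at this
    linarith
  have hp : ‖p n (a + c) - p n a‖ ≤ η := by
    refine abs_le_of_sq_le_sq' ?_ hη.le |>.2
    have : 2 * ω * SV (fun k => p n (a + k)) c ≤ 2 * ω * (K + 1) := by gcongr; linarith
    norm_num at key
    linarith
  refine ⟨hp, ?_⟩
  have e : x n (a + c) - x n a = (W ((a + c : ℕ) / 2 ^ n) - W (a / 2 ^ n)) + (p n (a + c) - p n a) := by
    rw [← h.eqn, ← h.eqn]; abel
  rw [e]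
  have := hW1 (a + c) (by omega) le_rfl
  have h6 := min_le_left η (η ^ 2 / (2 * (K + 1)))
  refine (norm_add_le _ _).trans ?_
  linarith

lemma Scheme.cauchy (h : Scheme C W x p) (hW : DMod W) {T q : ℕ} {K : ℝ} (hK0 : 0 ≤ K)
    (hK : ∀ n ≥ q, SV (p n) (T * 2 ^ n) ≤ K) {η : ℝ} (hη : 0 < η) :
    ∃ r : ℕ, ∀ n ≥ r, ∀ m ≥ n, ∀ k ≤ T * 2 ^ m, ‖p n (k / 2 ^ (m - n)) - p m k‖ ≤ η := by
  set ω := η ^ 2 / (4 * (K + 1)) with hω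
  have hω0 : 0 < ω := by positivity
  obtain ⟨r, hr⟩ := hW T ω hω0
  refine ⟨max q r, fun n hn m hm k hk => ?_⟩
  have hn1 : q ≤ n := (le_max_left _ _).trans hn
  have e0 : 2 ^ m = 2 ^ n * 2 ^ (m - n) := by rw [← pow_add]; congr 1; omega
  have e1 : (2:ℝ) ^ m = 2 ^ n * 2 ^ (m - n) := by exact_mod_cast e0
  have hdiv : ∀ j, j ≤ T * 2 ^ m → j / 2 ^ (m - n) ≤ T * 2 ^ n := by
    intro j hj
    refine Nat.div_le_of_le_mul ?_
    rw [e0] at hj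
    calc j ≤ _ := hj
      _ = _ := by ring
  have key := DSol.key (h.dsol_refine n k (2 ^ (m - n))) (h.dsol m k) ω (fun j hj => by
    rw [h.eqn, h.eqn]
    refine hr _ (grid_mem (hdiv j (hj.trans hk))) _ (grid_mem (hj.trans hk)) ?_
    have d1 : (2 ^ (m - n) * (j / 2 ^ (m - n)) : ℕ) ≤ j := Nat.mul_div_le _ _
    have d2 : j < 2 ^ (m - n) * (j / 2 ^ (m - n) + 1) := by
      have := Nat.lt_mul_div_succ j (b := 2 ^ (m - n)) (by positivity)
      exact this
    have d1' : (2 ^ (m - n) * (j / 2 ^ (m - n) : ℕ) : ℝ) ≤ j := by exact_mod_cast d1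
    have d2' : (j:ℝ) ≤ 2 ^ (m - n) * ((j / 2 ^ (m - n) : ℕ) + 1) := by exact_mod_cast d2.le
    have b1 : (0:ℝ) < 2 ^ (m - n) := by positivity
    have b2 : (0:ℝ) < 2 ^ n := by positivity
    have e2 : ((j / 2 ^ (m - n) : ℕ) : ℝ) / 2 ^ n
      = 2 ^ (m - n) * ((j / 2 ^ (m - n) : ℕ) : ℝ) / 2 ^ m := by
      rw [e1]; field_simp
    rw [e2, ← sub_div, abs_div, abs_of_nonneg (show (0:ℝ) ≤ 2 ^ m by positivity)]
    have h1 : |2 ^ (m - n) * ((j / 2 ^ (m - n) : ℕ) : ℝ) - j| ≤ 2 ^ (m - n) := by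
      rw [abs_le]; constructor <;> linarith
    calc _ ≤ (2:ℝ) ^ (m - n) / 2 ^ m := by gcongr
      _ = 1 / 2 ^ n := by rw [e1]; field_simp
      _ ≤ 1 / 2 ^ r := one_div_le_one_div_of_le (by positivity)
        (pow_le_pow_right₀ (by norm_num) ((le_max_right _ _).trans hn)))
  rw [SV_refine] at key
  have s1 := (SV_mono (p n) (hdiv k hk)).trans (hK n hn1)
  have s2 := (SV_mono (p m) hk).trans (hK m (hn1.trans hm))
  refine abs_le_of_sq_le_sq' ?_ hη.le |>.2
  simp only [Nat.zero_div, h.p0, sub_self, norm_zero, add_zero, Finset.sum_const_zero, mul_zero] at key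
  have h3 : 2 * ω * (SV (p n) (k / 2 ^ (m - n)) + SV (p m) k) ≤ 2 * ω * (2 * (K + 1)) := by
    gcongr; linarith
  have h4 : 2 * ω * (2 * (K + 1)) = η ^ 2 := by rw [hω]; field_simp; ring
  norm_num at key
  linarith

/-- Continuous-time version of the discrete regulator. -/
def stepP (p : ℕ → ℕ → E) (n : ℕ) (t : ℝ) : E := p n ⌊t * 2 ^ n⌋₊

lemma floor_le_T {T n : ℕ} {t : ℝ} (ht : t ≤ T) : ⌊t * 2 ^ n⌋₊ ≤ T * 2 ^ n := by
  have : t * 2 ^ n ≤ ((T * 2 ^ n : ℕ) : ℝ) := by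
    push_cast; gcongr
  exact (Nat.floor_le_floor this).trans (by rw [Nat.floor_natCast])

lemma stepP_grid (n k : ℕ) : stepP p n ((k:ℝ) / 2 ^ n) = p n k := by
  unfold stepP
  rw [div_mul_cancel₀ _ (by positivity), Nat.floor_natCast]

lemma Scheme.step_cauchy (h : Scheme C W x p) (hW : DMod W) {T q : ℕ} {K : ℝ} (hK0 : 0 ≤ K)
    (hK : ∀ n ≥ q, SV (p n) (T * 2 ^ n) ≤ K) {η : ℝ} (hη : 0 < η) :
    ∃ r : ℕ, ∀ n ≥ r, ∀ m ≥ n, ∀ t ≤ (T:ℝ), ‖stepP p n t - stepP p m t‖ ≤ η := by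
  obtain ⟨r, hr⟩ := h.cauchy hW hK0 hK hη
  refine ⟨r, fun n hn m hm t ht => ?_⟩
  have := hr n hn m hm _ (floor_le_T (n := m) ht)
  have e1 : (2:ℝ) ^ m = 2 ^ n * 2 ^ (m - n) := by rw [← pow_add]; congr 1; omega
  have e : ⌊t * 2 ^ m⌋₊ / 2 ^ (m - n) = ⌊t * 2 ^ n⌋₊ := by
    have h1 := Nat.floor_div_natCast (t * 2 ^ m) (2 ^ (m - n))
    rw [← h1]
    congr 1
    push_cast
    rw [e1]; field_simp
  rw [e] at this
  exact this

lemma Scheme.exists_limit [CompleteSpace E] (h : Scheme C W x p) (hW : DMod W) {x₀ : E} {ε : ℝ}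
    (hε : 0 < ε) (hC : Metric.closedBall x₀ ε ⊆ C) :
    ∃ φ : ℝ → E, ∀ T : ℕ, ∀ η : ℝ, 0 < η → ∃ r : ℕ, ∀ n ≥ r, ∀ t ≤ (T:ℝ),
      ‖stepP p n t - φ t‖ ≤ η := by
  have hc : ∀ T : ℕ, ∀ η : ℝ, 0 < η → ∃ r : ℕ, ∀ n ≥ r, ∀ m ≥ n, ∀ t ≤ (T:ℝ),
      ‖stepP p n t - stepP p m t‖ ≤ η := by
    intro T η hη
    obtain ⟨K, hK0, q, hK⟩ := h.bdd hW hε hC T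
    exact h.step_cauchy hW hK0 hK hη
  have hl : ∀ t : ℝ, ∃ l, Tendsto (fun n => stepP p n t) atTop (𝓝 l) := by
    intro t
    obtain ⟨T, hT⟩ := exists_nat_ge t
    apply cauchySeq_tendsto_of_complete
    rw [Metric.cauchySeq_iff']
    intro η hη
    obtain ⟨r, hr⟩ := hc T (η / 2) (by positivity)
    refine ⟨r, fun n hn => ?_⟩
    rw [dist_comm, dist_eq_norm]
    linarith [hr r le_rfl n hn t hT]
  choose φ hφ using hl
  refine ⟨φ, fun T η hη => ?_⟩
  obtain ⟨r, hr⟩ := hc T η hη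
  refine ⟨r, fun n hn t ht => ?_⟩
  refine le_of_tendsto ((tendsto_const_nhds.sub (hφ t)).norm) ?_
  filter_upwards [eventually_ge_atTop n] with m hm
  exact hr n hn m hm t ht

end Scheme


section Limit

variable {E : Type*} [NormedAddCommGroup E] [InnerProductSpace ℝ E]
variable {C : Set E} {W φ : ℝ → E} {x p : ℕ → ℕ → E}

/-- `φ` is the locally uniform limit of the discrete regulators. -/
def IsLim (p : ℕ → ℕ → E) (φ : ℝ → E) : Prop :=
  ∀ T : ℕ, ∀ η : ℝ, 0 < η → ∃ r : ℕ, ∀ n ≥ r, ∀ t ≤ (T:ℝ), ‖stepP p n t - φ t‖ ≤ η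

lemma IsLim.tendsto (h : IsLim p φ) (t : ℝ) : Tendsto (fun n => stepP p n t) atTop (𝓝 (φ t)) := by
  obtain ⟨T, hT⟩ := exists_nat_ge t
  rw [Metric.tendsto_atTop]
  intro η hη
  obtain ⟨r, hr⟩ := h T (η / 2) (by positivity)
  refine ⟨r, fun n hn => ?_⟩
  rw [dist_eq_norm]
  linarith [hr n hn t hT]

lemma IsLim.zero (h : IsLim p φ) (hS : Scheme C W x p) {t : ℝ} (ht : t ≤ 0) : φ t = 0 := by
  refine tendsto_nhds_unique (h.tendsto t) ?_
  have : ∀ n, stepP p n t = 0 := fun n => by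
    unfold stepP
    rw [Nat.floor_of_nonpos (mul_nonpos_of_nonpos_of_nonneg ht (by positivity)), hS.p0]
  simp [this]

lemma floor_diff {u v : ℝ} (huv : u ≤ v) (n : ℕ) :
    ((⌊v * 2 ^ n⌋₊ : ℝ) - ⌊u * 2 ^ n⌋₊) / 2 ^ n ≤ (v - u) + 1 / 2 ^ n := by
  have hpos : (0:ℝ) < 2 ^ n := by positivity
  have h1 : u * 2 ^ n < ⌊u * 2 ^ n⌋₊ + 1 := Nat.lt_floor_add_one _
  have h2 : (⌊v * 2 ^ n⌋₊ : ℝ) ≤ ⌊u * 2 ^ n⌋₊ + (v - u) * 2 ^ n + 1 := by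
    rcases le_total 0 v with hv | hv
    · have := Nat.floor_le (mul_nonneg hv hpos.le)
      linarith
    · rw [Nat.floor_of_nonpos (mul_nonpos_of_nonpos_of_nonneg hv hpos.le)]
      have : 0 ≤ (v - u) * 2 ^ n := mul_nonneg (by linarith) hpos.le
      push_cast
      positivity
  rw [div_le_iff₀ hpos, add_mul, one_div, inv_mul_cancel₀ hpos.ne']
  linarith

lemma floor_diff_small {u v : ℝ} (huv : u ≤ v) {r n : ℕ} (hn : r + 1 ≤ n)
    (h : v - u ≤ 1 / 2 ^ (r + 1)) :
    ((⌊v * 2 ^ n⌋₊ : ℝ) - ⌊u * 2 ^ n⌋₊) / 2 ^ n ≤ 1 / 2 ^ r := by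
  have h1 := floor_diff huv n
  have h2 : (1:ℝ) / 2 ^ n ≤ 1 / 2 ^ (r + 1) := one_div_le_one_div_of_le (by positivity)
        (pow_le_pow_right₀ (by norm_num) hn)
  have h3 : (1:ℝ) / 2 ^ r = 1 / 2 ^ (r + 1) + 1 / 2 ^ (r + 1) := by
    rw [pow_succ]; field_simp; norm_num
  linarith

lemma floor_mono2 {u v : ℝ} (huv : u ≤ v) (n : ℕ) : ⌊u * 2 ^ n⌋₊ ≤ ⌊v * 2 ^ n⌋₊ :=
  Nat.floor_le_floor (mul_le_mul_of_nonneg_right huv (by positivity))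

lemma IsLim.continuous (h : IsLim p φ) (hS : Scheme C W x p) (hW : DMod W)
    (hbd : ∀ T : ℕ, ∃ K : ℝ, 0 ≤ K ∧ ∃ q : ℕ, ∀ n ≥ q, SV (p n) (T * 2 ^ n) ≤ K) :
    Continuous φ := by
  have main : ∀ T : ℕ, ∀ η > 0, ∃ δ > 0, ∀ u v : ℝ, u ≤ v → v ≤ T → v - u ≤ δ →
      ‖φ v - φ u‖ ≤ η := by
    intro T η hη
    obtain ⟨K, hK0, q, hK⟩ := hbd T
    obtain ⟨r, hr⟩ := hS.equi hW hK0 hK hη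
    refine ⟨1 / 2 ^ (r + 1), by positivity, fun u v huv hv hd => ?_⟩
    refine le_of_tendsto ((h.tendsto v).sub (h.tendsto u)).norm ?_
    filter_upwards [eventually_ge_atTop (r + 1)] with n hn
    exact (hr n (by omega) _ _ (floor_mono2 huv n) (floor_le_T hv) (floor_diff_small huv hn hd)).1
  rw [Metric.continuous_iff]
  intro t η hη
  obtain ⟨T, hT⟩ := exists_nat_ge (t + 1)
  obtain ⟨δ, hδ, hm⟩ := main T (η / 2) (by positivity)
  refine ⟨min δ 1, by positivity, fun s hs => ?_⟩
  rw [Real.dist_eq] at hs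
  have h1 := hs.trans_le (min_le_left _ _)
  have h2 := hs.trans_le (min_le_right _ _)
  rw [abs_lt] at h1 h2
  rw [dist_eq_norm]
  rcases le_total s t with hst | hst
  · rw [norm_sub_rev]
    linarith [hm s t hst (by linarith) (by linarith)]
  · linarith [hm t s hst (by linarith) (by linarith)]

lemma IsLim.evar (h : IsLim p φ) {T q : ℕ} {K : ℝ}
    (hK : ∀ n ≥ q, SV (p n) (T * 2 ^ n) ≤ K) :
    eVariationOn φ (Iic (T:ℝ)) ≤ ENNReal.ofReal K := by
  refine iSup_le ?_
  rintro ⟨m, u, hu, hum⟩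
  have hlim : Tendsto (fun n => ∑ i ∈ Finset.range m, edist (stepP p n (u (i + 1))) (stepP p n (u i)))
      atTop (𝓝 (∑ i ∈ Finset.range m, edist (φ (u (i + 1))) (φ (u i)))) :=
    tendsto_finsetSum _ fun i _ => (h.tendsto _).edist (h.tendsto _)
  refine le_of_tendsto hlim ?_
  filter_upwards [eventually_ge_atTop q] with n hn
  have e : ∀ i ∈ Finset.range m, edist (stepP p n (u (i + 1))) (stepP p n (u i))
      ≤ ENNReal.ofReal (SV (p n) ⌊u (i + 1) * 2 ^ n⌋₊ - SV (p n) ⌊u i * 2 ^ n⌋₊) := by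
    intro i _
    rw [edist_dist, dist_eq_norm]
    exact ENNReal.ofReal_le_ofReal (norm_sub_le_SV_sub _ (floor_mono2 (hu (Nat.le_succ i)) n))
  refine (Finset.sum_le_sum e).trans ?_
  rw [← ENNReal.ofReal_sum_of_nonneg (fun i _ => by
    linarith [SV_mono (p n) (floor_mono2 (hu (Nat.le_succ i)) n)])]
  refine ENNReal.ofReal_le_ofReal ?_
  rw [Finset.sum_range_sub (fun i => SV (p n) ⌊u i * 2 ^ n⌋₊)]
  have := SV_nonneg (p n) ⌊u 0 * 2 ^ n⌋₊
  have h2 := SV_mono (p n) (floor_le_T (n := n) (hum m))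
  linarith [hK n hn]

lemma Scheme.x_tendsto (hS : Scheme C W x p) (h : IsLim p φ) (hW : Continuous W) {t : ℝ}
    (ht : 0 ≤ t) : Tendsto (fun n => x n ⌊t * 2 ^ n⌋₊) atTop (𝓝 (W t + φ t)) := by
  have e : ∀ n, x n ⌊t * 2 ^ n⌋₊ = W ((⌊t * 2 ^ n⌋₊ : ℝ) / 2 ^ n) + stepP p n t := fun n => by
    rw [← hS.eqn]; unfold stepP; abel
  simp only [e]
  refine Tendsto.add ((hW.tendsto t).comp ?_) (h.tendsto t)
  have h1 : Tendsto (fun n : ℕ => (2:ℝ) ^ n) atTop atTop :=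
    tendsto_pow_atTop_atTop_of_one_lt (by norm_num)
  exact (tendsto_nat_floor_mul_div_atTop ht).comp h1

lemma Scheme.lim_mem (hS : Scheme C W x p) (h : IsLim p φ) (hW : Continuous W) (hC : IsClosed C)
    {t : ℝ} (ht : 0 ≤ t) : W t + φ t ∈ C :=
  hC.mem_of_tendsto (hS.x_tendsto h hW ht) (Eventually.of_forall fun n => hS.mem n _)

lemma Scheme.cell (hS : Scheme C W x p) {n a b : ℕ} {Ω : ℝ} (hab : a ≤ b)
    (hΩ : ∀ k, a ≤ k → k ≤ b → ‖x n b - x n k‖ ≤ Ω) {y : E} (hy : y ∈ C) :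
    - (Ω * (SV (p n) b - SV (p n) a)) ≤ inner ℝ (y - x n b) (p n b - p n a) := by
  have gen : ∀ c, a ≤ c → c ≤ b →
      - (Ω * (SV (p n) c - SV (p n) a)) ≤ inner ℝ (y - x n b) (p n c - p n a) := by
    intro c hc
    induction c, hc using Nat.le_induction with
    | base => simp
    | succ c hc ih =>
      intro hcb
      have ih := ih (by omega)
      have e : (inner ℝ (y - x n b) (p n (c + 1) - p n a) : ℝ)
          = inner ℝ (y - x n b) (p n c - p n a) + inner ℝ (y - x n (c + 1)) (p n (c + 1) - p n c)
            - inner ℝ (x n b - x n (c + 1)) (p n (c + 1) - p n c) := by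
        rw [add_sub_assoc, ← inner_sub_left]
        have e1 : y - x n (c + 1) - (x n b - x n (c + 1)) = y - x n b := by abel
        rw [e1, ← inner_add_right]
        congr 1; abel
      have h1 := hS.nrm n c y hy
      have h2 := real_inner_le_norm (x n b - x n (c + 1)) (p n (c + 1) - p n c)
      have h3 : ‖x n b - x n (c + 1)‖ * ‖p n (c + 1) - p n c‖ ≤ Ω * ‖p n (c + 1) - p n c‖ :=
        mul_le_mul_of_nonneg_right (hΩ _ (by omega) hcb) (norm_nonneg _)
      rw [e, SV_succ]
      nlinarith
  exact gen b hab le_rfl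

lemma Scheme.riemann (hS : Scheme C W x p) (h : IsLim p φ) (hW : Continuous W) {T q : ℕ} {K : ℝ}
    (hK0 : 0 ≤ K) (hK : ∀ n ≥ q, SV (p n) (T * 2 ^ n) ≤ K) {Ω : ℝ} (hΩ : 0 < Ω) :
    ∃ δ > 0, ∀ (u : ℕ → ℝ) (N : ℕ) (y : ℕ → E), Monotone u → 0 ≤ u 0 → (∀ k, k ≤ N → u k ≤ T) →
      (∀ k < N, u (k + 1) - u k ≤ δ) → (∀ k < N, y k ∈ C) →
      - (Ω * K) ≤ ∑ k ∈ Finset.range N,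
        inner ℝ (y k - (W (u (k + 1)) + φ (u (k + 1)))) (φ (u (k + 1)) - φ (u k)) := by
  obtain ⟨r, hr⟩ := hS.equi (dmod_of_continuous hW) hK0 hK (half_pos hΩ)
  refine ⟨1 / 2 ^ (r + 1), by positivity, fun u N y hu hu0 huT hud hy => ?_⟩
  have hlim : Tendsto (fun n => ∑ k ∈ Finset.range N,
      (inner ℝ (y k - x n ⌊u (k + 1) * 2 ^ n⌋₊) (stepP p n (u (k + 1)) - stepP p n (u k)) : ℝ)) atTop
      (𝓝 (∑ k ∈ Finset.range N,
        inner ℝ (y k - (W (u (k + 1)) + φ (u (k + 1)))) (φ (u (k + 1)) - φ (u k)))) := by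
    refine tendsto_finsetSum _ fun k _ => ?_
    exact (tendsto_const_nhds.sub (hS.x_tendsto h hW (hu0.trans (hu (Nat.zero_le _))))).inner
      ((h.tendsto _).sub (h.tendsto _))
  refine ge_of_tendsto hlim ?_
  filter_upwards [eventually_ge_atTop (r + 1), eventually_ge_atTop q] with n hn hnq
  have e : ∀ k ∈ Finset.range N,
      - (Ω * (SV (p n) ⌊u (k + 1) * 2 ^ n⌋₊ - SV (p n) ⌊u k * 2 ^ n⌋₊)) ≤
      (inner ℝ (y k - x n ⌊u (k + 1) * 2 ^ n⌋₊) (stepP p n (u (k + 1)) - stepP p n (u k)) : ℝ) := by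
    intro k hk
    rw [Finset.mem_range] at hk
    refine hS.cell (floor_mono2 (hu (Nat.le_succ k)) n) (fun j hj1 hj2 => ?_) (hy k hk)
    have h1 := floor_diff_small (hu (Nat.le_succ k)) hn (hud k hk)
    have h2 := (hr n (by omega) j _ hj2 (floor_le_T (huT _ hk)) (le_trans (by
      have : ((⌊u k * 2 ^ n⌋₊ : ℕ) : ℝ) ≤ j := by exact_mod_cast hj1
      gcongr) h1)).2
    linarith
  refine le_trans ?_ (Finset.sum_le_sum e)
  rw [Finset.sum_neg_distrib, ← Finset.mul_sum,
    Finset.sum_range_sub (fun i => SV (p n) ⌊u i * 2 ^ n⌋₊)]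
  have h1 := SV_nonneg (p n) ⌊u 0 * 2 ^ n⌋₊
  have h2 := (SV_mono (p n) (floor_le_T (n := n) (huT N le_rfl))).trans (hK n hnq)
  have h3 : Ω * (SV (p n) ⌊u N * 2 ^ n⌋₊ - SV (p n) ⌊u 0 * 2 ^ n⌋₊) ≤ Ω * K := by
    gcongr; linarith
  linarith

lemma Scheme.loc_const (hS : Scheme C W x p) (h : IsLim p φ) (hW : Continuous W)
    (hφ : Continuous φ) {D : Set E} (hD : IsOpen D) (hDC : D ⊆ C) {t : ℝ}
    (hX : W t + φ t ∈ D) : ∃ δ > 0, ∀ u v, t - δ ≤ u → u ≤ v → v ≤ t + δ → φ u = φ v := by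
  obtain ⟨ρ, hρ, hb⟩ := Metric.isOpen_iff.1 hD _ hX
  obtain ⟨δ, hδ, hc⟩ := Metric.continuous_iff.1 (hW.add hφ) t (ρ / 4) (by positivity)
  obtain ⟨T, hT⟩ := exists_nat_ge (t + δ)
  obtain ⟨r, hr⟩ := h T (ρ / 4) (by positivity)
  refine ⟨δ / 2, by positivity, fun u v hu huv hv => ?_⟩
  refine tendsto_nhds_unique (h.tendsto u) ((h.tendsto v).congr' ?_)
  filter_upwards [eventually_ge_atTop r] with n hn
  have gen : ∀ b, ⌊u * 2 ^ n⌋₊ ≤ b → b ≤ ⌊v * 2 ^ n⌋₊ → p n b = p n ⌊u * 2 ^ n⌋₊ := by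
    intro b hb'
    induction b, hb' using Nat.le_induction with
    | base => simp
    | succ c hc' ih =>
      intro hcv
      rw [← ih (by omega)]
      have hpos : (0:ℝ) < 2 ^ n := by positivity
      set s : ℝ := ((c + 1 : ℕ) : ℝ) / 2 ^ n with hs
      have h1 : u ≤ s := by
        rw [hs, le_div_iff₀ hpos]
        exact (Nat.lt_of_floor_lt (by omega)).le
      have h2 : s ≤ v := by
        rw [hs, div_le_iff₀ hpos]
        exact (Nat.le_floor_iff' (by omega)).1 hcv
      have h3 : dist (W s + φ s) (W t + φ t) < ρ / 4 := hc s (by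
        rw [Real.dist_eq, abs_lt]; constructor <;> linarith)
      have h4 := hr n hn s (by linarith)
      have e1 : stepP p n s = p n (c + 1) := stepP_grid n (c + 1)
      have e2 : x n (c + 1) = W s + p n (c + 1) := by
        rw [hs, ← hS.eqn]; abel
      rw [e1] at h4
      have h5 : dist (x n (c + 1)) (W s + φ s) ≤ ρ / 4 := by
        rw [e2, dist_add_left, dist_eq_norm]; exact h4
      refine hS.interior_zero (ε := ρ / 4) (by positivity) (fun z hz => hDC (hb ?_))
      rw [Metric.mem_closedBall] at hz
      rw [Metric.mem_ball]
      have t1 := dist_triangle z (x n (c + 1)) (W t + φ t)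
      have t2 := dist_triangle (x n (c + 1)) (W s + φ s) (W t + φ t)
      linarith
  exact gen _ (floor_mono2 huv n) le_rfl

end Limit

section MeasData

variable {d : ℕ}

lemma exists_measData {φ : ℝ → Euc d} (hc : Continuous φ)
    (hbv : LocallyBoundedVariationOn φ univ) :
    ∃ M : BVMeasureData d φ, ∀ s t : ℝ, s ≤ t → M.var (Ioc s t) = eVariationOn φ (Icc s t) := by
  set V : ℝ → ℝ := variationOnFromTo φ univ 0 with hV
  have hsub : ∀ s t, s ≤ t → V t - V s = (eVariationOn φ (Icc s t)).toReal := by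
    intro s t hst
    rw [hV, variationOnFromTo.sub_right hbv (mem_univ _) (mem_univ _) (mem_univ _),
      variationOnFromTo.eq_of_le _ _ hst, univ_inter]
  have hfin : ∀ s t, eVariationOn φ (Icc s t) ≠ ⊤ := fun s t => by
    have h1 := hbv s t (mem_univ _) (mem_univ _)
    rw [univ_inter] at h1
    exact h1
  have hmono : Monotone V := fun a b hab =>
    variationOnFromTo.monotoneOn hbv (mem_univ 0) (mem_univ a) (mem_univ b) hab
  have hrc : ∀ t, ContinuousWithinAt V (Ici t) t := by
    intro t
    rw [← continuousWithinAt_Ioi_iff_Ici]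
    have := variationOnFromTo.tendsto_right (a := (0:ℝ)) (b := t) (mem_univ _) (mem_univ _) hbv
      (l := φ t) ((hc.tendsto t).mono_left nhdsWithin_le_nhds)
    simpa [ContinuousWithinAt] using this
  have hinc : ∀ i : Fin d, ∀ s t, s ≤ t → φ t i - φ s i ≤ V t - V s := by
    intro i s t hst
    rw [hsub s t hst]
    have h1 : edist (φ t) (φ s) ≤ eVariationOn φ (Icc s t) :=
      eVariationOn.edist_le φ ⟨hst, le_rfl⟩ ⟨le_rfl, hst⟩
    have h2 := ENNReal.toReal_mono (hfin s t) h1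
    rw [← dist_edist, dist_eq_norm] at h2
    have h3 := abs_coord_le (φ t - φ s) i
    have h4 := le_abs_self ((φ t - φ s) i)
    simp only [PiLp.sub_apply] at h3 h4
    linarith
  let F : StieltjesFunction ℝ := ⟨V, hmono, hrc⟩
  let G : Fin d → StieltjesFunction ℝ := fun i => ⟨fun t => V t - φ t i, fun a b hab => by
    have := hinc i a b hab
    simp only; linarith, fun t => (hrc t).sub (by
      have : Continuous fun t => φ t i := by fun_prop
      exact this.continuousWithinAt)⟩
  have hF : ∀ s t : ℝ, s ≤ t → F.measure (Ioc s t) = eVariationOn φ (Icc s t) := by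
    intro s t hst
    rw [StieltjesFunction.measure_Ioc]
    show ENNReal.ofReal (V t - V s) = _
    rw [hsub s t hst, ENNReal.ofReal_toReal (hfin s t)]
  refine ⟨⟨fun _ => F.measure, fun i => (G i).measure, F.measure, fun i t => ?_, fun i t => ?_, ?_,
    fun s t _ hst => hF s t hst⟩, hF⟩
  · exact measure_Icc_lt_top
  · exact measure_Icc_lt_top
  · intro i s t _ hst
    rw [StieltjesFunction.measure_Ioc, StieltjesFunction.measure_Ioc]
    show (ENNReal.ofReal (V t - V s)).toReal - (ENNReal.ofReal ((V t - φ t i) - (V s - φ s i))).toReal = _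
    have := hinc i s t hst
    have := hmono hst
    rw [ENNReal.toReal_ofReal (by linarith), ENNReal.toReal_ofReal (by linarith)]
    ring

end MeasData

section Existence

variable {d : ℕ}

lemma pairing_sum {φ : ℝ → Euc d} (M : BVMeasureData d φ) {f : ℝ → Euc d} {r : ℕ → ℝ}
    (hr : Monotone r) (hr0 : 0 ≤ r 0) {m : ℕ} (hf : ∀ k ≤ m, M.IntOn f (r 0) (r k)) :
    M.pairing f (r 0) (r m) = ∑ k ∈ Finset.range m, M.pairing f (r k) (r (k + 1)) := by
  induction m with
  | zero => simp [BVMeasureData.pairing]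
  | succ m ih =>
    rw [Finset.sum_range_succ, ← ih fun k hk => hf k (by omega)]
    exact M.pairing_add (hr (Nat.zero_le m)) (hr (Nat.le_succ m)) (hf _ le_rfl)

lemma skor_exists {D : Set (Euc d)} (hne : D.Nonempty) (hconv : Convex ℝ D) (hopen : IsOpen D)
    {w : ℝ → Euc d} (hw : ContinuousOn w (Ici 0)) (hw0 : w 0 ∈ closure D) :
    ∃ (X φ : ℝ → Euc d) (M : BVMeasureData d φ), IsSkorohodSolution D w X φ M := by
  set W : ℝ → Euc d := fun t => w (max t 0) with hWdef
  have hWc : Continuous W :=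
    hw.comp_continuous (by fun_prop) (fun t => mem_Ici.2 (le_max_right _ _))
  have hWw : ∀ t, 0 ≤ t → W t = w t := fun t ht => by simp [hWdef, ht]
  have hWm := dmod_of_continuous hWc
  obtain ⟨x, p, hS⟩ := exists_scheme (C := closure D) isClosed_closure hconv.closure (W := W)
    (by rw [hWw 0 le_rfl]; exact hw0)
  obtain ⟨x₀, ε, hε, hball⟩ := exists_ball hne hopen
  have hbd := hS.bdd hWm hε hball
  obtain ⟨φ, hφ⟩ := hS.exists_limit hWm hε hball
  have hL : IsLim p φ := hφ
  have hc := hL.continuous hS hWm hbd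
  have hIic : ∀ t : ℝ, eVariationOn φ (Iic t) < ⊤ := by
    intro t
    obtain ⟨T, hT⟩ := exists_nat_ge t
    obtain ⟨K, -, q, hK⟩ := hbd T
    exact ((eVariationOn.mono φ (Iic_subset_Iic.2 hT)).trans (hL.evar hK)).trans_lt
      ENNReal.ofReal_lt_top
  have hbv : LocallyBoundedVariationOn φ univ := fun a b _ _ =>
    ((eVariationOn.mono φ (fun z hz => hz.2.2)).trans_lt (hIic b)).ne
  obtain ⟨M, hM⟩ := exists_measData hc hbv
  have hXc : Continuous fun t => W t + φ t := hWc.add hc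
  refine ⟨fun t => W t + φ t, φ, M, fun t _ => hXc.continuousWithinAt,
    fun t _ => ⟨_, (hXc.tendsto t).mono_left nhdsWithin_le_nhds⟩,
    fun t ht => hS.lim_mem hL hWc isClosed_closure ht, fun t ht => by simp only [hWw t ht],
    fun t _ => hc.continuousWithinAt, fun t _ => ⟨_, (hc.tendsto t).mono_left nhdsWithin_le_nhds⟩,
    fun t _ => (eVariationOn.mono φ (fun z hz => hz.2)).trans_lt (hIic t), hL.zero hS le_rfl, ?_, ?_⟩
  · refine measure_null_of_locally_null _ fun t ht => ?_
    obtain ⟨δ, hδ, hcst⟩ := hS.loc_const hL hWc hc hopen subset_closure ht.2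
    refine ⟨Ioc (t - δ) (t + δ), mem_nhdsWithin_of_mem_nhds
      (Ioc_mem_nhds (by linarith) (by linarith)), ?_⟩
    rw [hM _ _ (by linarith), eVariationOn.eq_zero_iff]
    intro a ha b hb
    rcases le_total a b with hab | hab
    · rw [hcst a b ha.1 hab hb.2, edist_self]
    · rw [hcst b a hb.1 hab ha.2, edist_self]
  · intro η hη hηC s t hs hst
    set f : ℝ → Euc d := fun τ => η τ - (W τ + φ τ) with hf
    have hfc : Continuous f := hη.sub hXc
    obtain ⟨T, hT⟩ := exists_nat_ge t
    obtain ⟨K, hK0, q, hK⟩ := hbd T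
    have hG := M.G_nonneg s t
    have main : ∀ Ω > 0, - (Ω * (K + M.G s t)) ≤ M.pairing f s t := by
      intro Ω hΩ
      obtain ⟨δ₁, hδ₁, hR⟩ := hS.riemann hL hWc hK0 hK hΩ
      obtain ⟨δ₂, hδ₂, hU⟩ := Metric.uniformContinuousOn_iff.1
        ((isCompact_Icc (a := s) (b := t)).uniformContinuousOn_of_continuous hfc.continuousOn) Ω hΩ
      obtain ⟨N, hN⟩ := exists_nat_gt ((t - s) / min δ₁ δ₂)
      have hm : 0 < min δ₁ δ₂ := by positivity
      have hN0 : (0:ℝ) < N := lt_of_le_of_lt (div_nonneg (by linarith) hm.le) hN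
      set c := (t - s) / N with hcdef
      have hc0 : 0 ≤ c := div_nonneg (by linarith) hN0.le
      have hcm : c < min δ₁ δ₂ := by
        rw [div_lt_iff₀ hm] at hN
        rw [hcdef, div_lt_iff₀ hN0]; linarith
      set r : ℕ → ℝ := fun k => s + k * c with hr
      have hrm : Monotone r := fun a b hab => by
        have : (a:ℝ) ≤ b := by exact_mod_cast hab
        simp only [hr]; gcongr
      have hr0 : r 0 = s := by simp [hr]
      have hrN : r N = t := by simp only [hr, hcdef]; field_simp; ring
      have hrs : ∀ k, r (k + 1) - r k = c := fun k => by simp only [hr]; push_cast; ring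
      have hk0 : ∀ k, 0 ≤ r k := fun k => (hs.trans hr0.ge).trans (hrm (Nat.zero_le k))
      have h1 := hR r N (fun k => η (r (k + 1))) hrm (hk0 0) (fun k hk => (hrm hk).trans (hrN ▸ hT))
        (fun k _ => by rw [hrs]; exact hcm.le.trans (min_le_left _ _)) (fun k _ => hηC _ (hk0 _))
      have hI : ∀ a b, 0 ≤ a → M.IntOn f a b := fun a b ha => M.intOn_cont ha hfc.continuousOn
      have h2 : ∀ k ∈ Finset.range N, (inner ℝ (f (r (k + 1))) (φ (r (k + 1)) - φ (r k)) : ℝ)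
          - Ω * M.G (r k) (r (k + 1)) ≤ M.pairing f (r k) (r (k + 1)) := by
        intro k hk
        rw [Finset.mem_range] at hk
        have := M.cell (hk0 k) (hrm (Nat.le_succ k)) (hI _ (r (k + 1)) (hk0 k)) (ω := Ω)
          (fun τ hτ => by
            have a1 : s ≤ r k := hr0 ▸ hrm (Nat.zero_le k)
            have a2 : r (k + 1) ≤ t := hrN ▸ hrm hk
            have a3 := hrs k
            have a4 := min_le_right δ₁ δ₂
            have := hU τ ⟨by linarith [hτ.1], hτ.2.trans a2⟩ (r (k + 1)) ⟨by linarith, a2⟩ (by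
              rw [Real.dist_eq, abs_lt]; constructor <;> linarith [hτ.1, hτ.2])
            rw [dist_eq_norm] at this
            exact this.le)
        rw [abs_le] at this
        linarith [this.1]
      have h3 := Finset.sum_le_sum h2
      rw [Finset.sum_sub_distrib, ← Finset.mul_sum, G_sum M hrm (hk0 0),
        ← pairing_sum M hrm (hk0 0) (fun k _ => hI _ _ (hk0 0)), hr0, hrN] at h3
      simp only [hf] at h3 ⊢
      nlinarith
    by_contra hneg
    push Not at hneg
    have hpos : 0 < K + M.G s t + 1 := by linarith
    have := main (- M.pairing f s t / (K + M.G s t + 1)) (div_pos (by linarith) hpos)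
    rw [div_mul_eq_mul_div, neg_le, ← neg_le_neg_iff, neg_neg] at this
    have h6 : -M.pairing f s t * (K + M.G s t) / (K + M.G s t + 1) < - M.pairing f s t := by
      rw [div_lt_iff₀ hpos]; nlinarith
    linarith

end Existence

/-- **Lemma 4.1.7.** Suppose the nonempty convex open set `D ⊆ ℝ^d` satisfies Condition B.
Then for every continuous `w : [0,∞) → ℝ^d` with `w(0) ∈ closure D` the Skorohod equation
`X = w + φ` has a unique solution, and the solution depends continuously on `w` with
respect to the topology of uniform convergence on compact subsets of `[0,∞)`. -/
theorem skorohod_exists_unique_of_condition_B {d : ℕ} (D : Set (Euc d)) (hne : D.Nonempty)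
    (hconv : Convex ℝ D) (hopen : IsOpen D) (hB : ConditionB D) :
    -- existence
    (∀ w : ℝ → Euc d, ContinuousOn w (Ici 0) → w 0 ∈ closure D →
      ∃ (X φ : ℝ → Euc d) (M : BVMeasureData d φ), IsSkorohodSolution D w X φ M) ∧
    -- uniqueness
    (∀ w : ℝ → Euc d, ContinuousOn w (Ici 0) → w 0 ∈ closure D →
      ∀ (X X' φ φ' : ℝ → Euc d) (M : BVMeasureData d φ) (M' : BVMeasureData d φ'),
        IsSkorohodSolution D w X φ M → IsSkorohodSolution D w X' φ' M' →
        ∀ t : ℝ, 0 ≤ t → X t = X' t ∧ φ t = φ' t) ∧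
    -- continuous dependence on w (uniform convergence on compacts)
    (∀ (wseq : ℕ → ℝ → Euc d) (w : ℝ → Euc d)
        (Xseq : ℕ → ℝ → Euc d) (φseq : ℕ → ℝ → Euc d)
        (Mseq : ∀ n : ℕ, BVMeasureData d (φseq n))
        (X φ : ℝ → Euc d) (M : BVMeasureData d φ),
      (∀ n, ContinuousOn (wseq n) (Ici 0)) → (∀ n, wseq n 0 ∈ closure D) →
      (∀ n, IsSkorohodSolution D (wseq n) (Xseq n) (φseq n) (Mseq n)) →
      ContinuousOn w (Ici 0) → w 0 ∈ closure D →
      IsSkorohodSolution D w X φ M →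
      (∀ T : ℝ, 0 < T → TendstoUniformlyOn wseq w atTop (Icc 0 T)) →
      (∀ T : ℝ, 0 < T → TendstoUniformlyOn Xseq X atTop (Icc 0 T))) := by
  refine ⟨fun w hw hw0 => skor_exists hne hconv hopen hw hw0,
    fun w hw _ X X' φ φ' M M' h h' t ht => skor_unique hne hopen h hw h' t ht, ?_⟩
  intro wseq w Xseq φseq Mseq X φ M hwn _ hn hw _ h hu T hT
  exact skor_cont hne hopen wseq w Xseq φseq Mseq X φ M hwn hn hw h T hT (hu T hT)

end
end

section
/- Let D be a nonempty convex open set in ℝ^d and let {w_n}_{n≥1} be a sequence of continuous functions from [0,∞) to ℝ^d with w_n(0) ∈ D̄ such that for each n the Skorohod equation X_n = w_n + φ_n has a solution. Assume w_n → w and X_n → X uniformly on compact subsets of [0,∞) as n → ∞, where w is continuous with w(0) ∈ D̄. Then, setting φ = X − w, the pair (X, φ) is a solution of the Skorohod equation X = w + φ. -/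
open MeasureTheory Set Filter Topology
open scoped RealInnerProductSpace

noncomputable section

lemma sk_chain (P : ℝ → ℝ → Prop) (a b δ : ℝ) (hδ : 0 < δ) (hab : a ≤ b)
    (hloc : ∀ s t, a ≤ s → s ≤ t → t ≤ b → t - s ≤ δ → P s t)
    (htr : ∀ s t u, a ≤ s → s ≤ t → t ≤ u → u ≤ b → P s t → P t u → P s u) : P a b := by
  have key : ∀ n : ℕ, ∀ t, a ≤ t → t ≤ b → t - a ≤ n * δ → P a t := by
    intro n
    induction n with
    | zero =>
      intro t h1 h2 h3
      refine hloc a t le_rfl h1 h2 ?_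
      simp at h3; linarith
    | succ k ih =>
      intro t h1 h2 h3
      push_cast at h3
      by_cases h : t - δ ≤ a
      · exact hloc a t le_rfl h1 h2 (by linarith)
      · push Not at h
        refine htr a (t - δ) t le_rfl h.le (by linarith) h2 (ih _ h.le (by linarith) (by linarith)) ?_
        exact hloc _ _ h.le (by linarith) h2 (by linarith)
  obtain ⟨n, hn⟩ := exists_nat_gt ((b - a) / δ)
  refine key n b hab le_rfl ?_
  rw [div_lt_iff₀ hδ] at hn
  exact hn.le

lemma sk_integrable (μ : Measure ℝ) (hμ : ∀ t, μ (Icc 0 t) < ⊤) (f : ℝ → ℝ) (s t : ℝ)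
    (hs : 0 ≤ s) (hf : ContinuousOn f (Icc s t)) : IntegrableOn f (Ioc s t) μ := by
  obtain ⟨C, hC⟩ := isCompact_Icc.exists_bound_of_continuousOn hf
  have hfin : μ (Icc s t) < ⊤ := lt_of_le_of_lt (measure_mono (Icc_subset_Icc_left hs)) (hμ t)
  refine IntegrableOn.mono_set (t := Icc s t) ?_ Ioc_subset_Icc_self
  refine IntegrableOn.of_bound hfin (hf.aestronglyMeasurable measurableSet_Icc) C ?_
  exact (ae_restrict_iff' measurableSet_Icc).2 (Eventually.of_forall hC)

lemma sk_fin_Ioc (μ : Measure ℝ) (hμ : ∀ t, μ (Icc 0 t) < ⊤) (s t : ℝ) (hs : 0 ≤ s) :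
    μ (Ioc s t) < ⊤ :=
  lt_of_le_of_lt (measure_mono (Ioc_subset_Icc_self.trans (Icc_subset_Icc_left hs))) (hμ t)

lemma sk_comp {d : ℕ} {f : ℝ → Euc d} {S : Set ℝ} (hf : ContinuousOn f S) (i : Fin d) :
    ContinuousOn (fun τ => f τ i) S := by
  fun_prop

section pairing

variable {d : ℕ} {φ : ℝ → Euc d} (M : BVMeasureData d φ)

lemma sk_pairing_add (f g : ℝ → Euc d) (s t : ℝ) (hs : 0 ≤ s) (hf : ContinuousOn f (Icc s t))
    (hg : ContinuousOn g (Icc s t)) :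
    M.pairing (fun τ => f τ + g τ) s t = M.pairing f s t + M.pairing g s t := by
  unfold BVMeasureData.pairing
  rw [← Finset.sum_add_distrib]
  refine Finset.sum_congr rfl fun i _ => ?_
  simp only [PiLp.add_apply]
  rw [integral_add (sk_integrable _ (M.pos_fin i) _ s t hs (sk_comp hf i))
    (sk_integrable _ (M.pos_fin i) _ s t hs (sk_comp hg i)),
    integral_add (sk_integrable _ (M.neg_fin i) _ s t hs (sk_comp hf i))
    (sk_integrable _ (M.neg_fin i) _ s t hs (sk_comp hg i))]
  ring

lemma sk_pairing_const (c : Euc d) (s t : ℝ) (hs : 0 ≤ s) (hst : s ≤ t) :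
    M.pairing (fun _ => c) s t = inner ℝ c (φ t - φ s) := by
  unfold BVMeasureData.pairing
  rw [PiLp.inner_apply]
  refine Finset.sum_congr rfl fun i _ => ?_
  simp only [setIntegral_const, smul_eq_mul, Measure.real, PiLp.sub_apply]
  rw [← M.increments i s t hs hst]
  simp [inner]
  ring

lemma sk_pairing_interval (f : ℝ → Euc d) (s t u : ℝ) (hs : 0 ≤ s) (hst : s ≤ t) (htu : t ≤ u)
    (hf : ContinuousOn f (Icc s u)) :
    M.pairing f s u = M.pairing f s t + M.pairing f t u := by
  unfold BVMeasureData.pairing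
  rw [← Finset.sum_add_distrib]
  refine Finset.sum_congr rfl fun i _ => ?_
  have h1 : ContinuousOn f (Icc s t) := hf.mono (Icc_subset_Icc_right htu)
  have h2 : ContinuousOn f (Icc t u) := hf.mono (Icc_subset_Icc_left hst)
  rw [← Ioc_union_Ioc_eq_Ioc hst htu,
    setIntegral_union (Ioc_disjoint_Ioc_of_le le_rfl) measurableSet_Ioc
      (sk_integrable _ (M.pos_fin i) _ s t hs (sk_comp h1 i))
      (sk_integrable _ (M.pos_fin i) _ t u (hs.trans hst) (sk_comp h2 i)),
    setIntegral_union (Ioc_disjoint_Ioc_of_le le_rfl) measurableSet_Ioc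
      (sk_integrable _ (M.neg_fin i) _ s t hs (sk_comp h1 i))
      (sk_integrable _ (M.neg_fin i) _ t u (hs.trans hst) (sk_comp h2 i))]
  ring

lemma sk_split (f : ℝ → Euc d) (c : Euc d) (s t : ℝ) (hs : 0 ≤ s) (hst : s ≤ t)
    (hf : ContinuousOn f (Icc s t)) :
    M.pairing f s t = inner ℝ c (φ t - φ s) + M.pairing (fun τ => f τ - c) s t := by
  rw [← sk_pairing_const M c s t hs hst, ← sk_pairing_add M (fun _ => c) (fun τ => f τ - c) s t hs
    continuousOn_const (hf.sub continuousOn_const)]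
  simp

def skK (s t : ℝ) : ℝ := ∑ i, ((M.pos i).real (Ioc s t) + (M.neg i).real (Ioc s t))

lemma skK_nonneg (s t : ℝ) : 0 ≤ skK M s t := by
  unfold skK; positivity

lemma skK_add (s t u : ℝ) (hs : 0 ≤ s) (hst : s ≤ t) (htu : t ≤ u) :
    skK M s u = skK M s t + skK M t u := by
  unfold skK
  rw [← Finset.sum_add_distrib]
  refine Finset.sum_congr rfl fun i _ => ?_
  rw [← Ioc_union_Ioc_eq_Ioc hst htu,
    measureReal_union (Ioc_disjoint_Ioc_of_le le_rfl) measurableSet_Ioc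
      (sk_fin_Ioc _ (M.pos_fin i) _ _ hs).ne (sk_fin_Ioc _ (M.pos_fin i) _ _ (hs.trans hst)).ne,
    measureReal_union (Ioc_disjoint_Ioc_of_le le_rfl) measurableSet_Ioc
      (sk_fin_Ioc _ (M.neg_fin i) _ _ hs).ne (sk_fin_Ioc _ (M.neg_fin i) _ _ (hs.trans hst)).ne]
  ring

lemma sk_crude (f : ℝ → Euc d) (s t C : ℝ) (hs : 0 ≤ s) (hC : ∀ τ ∈ Ioc s t, ‖f τ‖ ≤ C) :
    |M.pairing f s t| ≤ C * skK M s t := by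
  unfold BVMeasureData.pairing skK
  rw [Finset.mul_sum]
  refine (Finset.abs_sum_le_sum_abs _ _).trans (Finset.sum_le_sum fun i _ => ?_)
  have hb : ∀ τ ∈ Ioc s t, ‖f τ i‖ ≤ C := fun τ hτ => (PiLp.norm_apply_le (f τ) i).trans (hC τ hτ)
  have h1 := norm_setIntegral_le_of_norm_le_const (μ := M.pos i)
    (sk_fin_Ioc _ (M.pos_fin i) _ _ hs) hb
  have h2 := norm_setIntegral_le_of_norm_le_const (μ := M.neg i)
    (sk_fin_Ioc _ (M.neg_fin i) _ _ hs) hb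
  rw [Real.norm_eq_abs] at h1 h2
  refine (abs_sub _ _).trans ?_
  linarith

end pairing

def skV {d : ℕ} (φ : ℝ → Euc d) (s t : ℝ) : ℝ := (eVariationOn φ (Icc s t)).toReal

lemma skV_nonneg {d : ℕ} (φ : ℝ → Euc d) (s t : ℝ) : 0 ≤ skV φ s t := ENNReal.toReal_nonneg

def skBV {d : ℕ} (φ : ℝ → Euc d) : Prop := ∀ t : ℝ, 0 ≤ t → eVariationOn φ (Icc 0 t) < ⊤

lemma skBV.fin {d : ℕ} {φ : ℝ → Euc d} (h : skBV φ) (s t : ℝ) (hs : 0 ≤ s) (hst : s ≤ t) :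
    eVariationOn φ (Icc s t) < ⊤ :=
  lt_of_le_of_lt (eVariationOn.mono _ (Icc_subset_Icc_left hs)) (h t (hs.trans hst))

lemma sk_eV_add {d : ℕ} (φ : ℝ → Euc d) (s t u : ℝ) (hst : s ≤ t) (htu : t ≤ u) :
    eVariationOn φ (Icc s u) = eVariationOn φ (Icc s t) + eVariationOn φ (Icc t u) := by
  have := eVariationOn.Icc_add_Icc φ (s := univ) hst htu (mem_univ _)
  simpa using this.symm

lemma skV_add {d : ℕ} {φ : ℝ → Euc d} (h : skBV φ) (s t u : ℝ) (hs : 0 ≤ s) (hst : s ≤ t)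
    (htu : t ≤ u) : skV φ s u = skV φ s t + skV φ t u := by
  unfold skV
  rw [sk_eV_add φ s t u hst htu, ENNReal.toReal_add (h.fin s t hs hst).ne
    (h.fin t u (hs.trans hst) htu).ne]

lemma skV_dist {d : ℕ} {φ : ℝ → Euc d} (h : skBV φ) (s t : ℝ) (hs : 0 ≤ s) (hst : s ≤ t) :
    ‖φ t - φ s‖ ≤ skV φ s t := by
  have := BoundedVariationOn.dist_le (f := φ) (s := Icc s t) (h.fin s t hs hst).ne
    (right_mem_Icc.2 hst) (left_mem_Icc.2 hst)
  rwa [dist_eq_norm] at this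

/-- uniform continuity on `[s,t]` -/
lemma sk_unif {d : ℕ} {f : ℝ → Euc d} {a b : ℝ} (hf : ContinuousOn f (Icc a b)) {ε : ℝ}
    (hε : 0 < ε) : ∃ δ > 0, ∀ s t, a ≤ s → s ≤ t → t ≤ b → t - s ≤ δ →
      ∀ τ ∈ Icc s t, ∀ σ ∈ Icc s t, ‖f τ - f σ‖ ≤ ε := by
  have h := isCompact_Icc.uniformContinuousOn_of_continuous hf
  rw [Metric.uniformContinuousOn_iff] at h
  obtain ⟨δ, hδ, h⟩ := h ε hε
  refine ⟨δ / 2, by positivity, fun s t hs hst htb hd τ hτ σ hσ => ?_⟩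
  rw [← dist_eq_norm]
  refine (h τ ⟨hs.trans hτ.1, hτ.2.trans htb⟩ σ ⟨hs.trans hσ.1, hσ.2.trans htb⟩ ?_).le
  rw [Real.dist_eq, abs_lt]
  constructor <;> linarith [hτ.1, hτ.2, hσ.1, hσ.2]

lemma sk_bound {d : ℕ} {φ : ℝ → Euc d} (M : BVMeasureData d φ) (hbv : skBV φ) (f : ℝ → Euc d)
    (s t C : ℝ) (hs : 0 ≤ s) (hst : s ≤ t) (hf : ContinuousOn f (Icc s t))
    (hC : ∀ τ ∈ Icc s t, ‖f τ‖ ≤ C) : |M.pairing f s t| ≤ C * skV φ s t := by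
  have key : ∀ ε > 0, |M.pairing f s t| ≤ C * skV φ s t + ε * skK M s t := by
    intro ε hε
    obtain ⟨δ, hδ, hu⟩ := sk_unif hf hε
    refine sk_chain (fun a b => |M.pairing f a b| ≤ C * skV φ a b + ε * skK M a b) s t δ hδ hst
      ?_ ?_
    · intro a b ha hab hb hd
      have ha0 := hs.trans ha
      have hfab : ContinuousOn f (Icc a b) := hf.mono (Icc_subset_Icc ha hb)
      rw [sk_split M f (f b) a b ha0 hab hfab]
      refine (abs_add_le _ _).trans (add_le_add ?_ ?_)
      · refine (abs_real_inner_le_norm _ _).trans ?_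
        have h1 := hC b ⟨ha.trans hab, hb⟩
        have h2 := skV_dist hbv a b ha0 hab
        exact mul_le_mul h1 h2 (norm_nonneg _) ((norm_nonneg _).trans h1)
      · refine sk_crude M _ a b ε ha0 fun τ hτ => ?_
        exact hu a b ha hab hb hd τ (Ioc_subset_Icc_self hτ) b (right_mem_Icc.2 hab)
    · intro a b c ha hab hbc hc h1 h2
      have ha0 := hs.trans ha
      rw [sk_pairing_interval M f a b c ha0 hab hbc (hf.mono (Icc_subset_Icc ha hc)),
        skV_add hbv a b c ha0 hab hbc, skK_add M a b c ha0 hab hbc]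
      refine (abs_add_le _ _).trans ?_
      linarith
  refine le_of_forall_pos_le_add fun ε hε => ?_
  have hk := skK_nonneg M s t
  refine (key (ε / (skK M s t + 1)) (by positivity)).trans ?_
  have : ε / (skK M s t + 1) * skK M s t ≤ ε := by
    rw [div_mul_eq_mul_div, div_le_iff₀ (by positivity)]
    nlinarith
  linarith

def skNormal {d : ℕ} (D : Set (Euc d)) (X : ℝ → Euc d) {φ : ℝ → Euc d}
    (M : BVMeasureData d φ) : Prop :=
  ∀ η : ℝ → Euc d, Continuous η → (∀ t : ℝ, 0 ≤ t → η t ∈ closure D) →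
    ∀ s t : ℝ, 0 ≤ s → s ≤ t → 0 ≤ M.pairing (fun τ => η τ - X τ) s t

section est

variable {d : ℕ} {D : Set (Euc d)} {X φ : ℝ → Euc d} {M : BVMeasureData d φ}

lemma sk_cont_Icc (hX : ContinuousOn X (Ici 0)) {s t : ℝ} (hs : 0 ≤ s) :
    ContinuousOn X (Icc s t) := hX.mono fun _ hx => hs.trans hx.1

lemma sk_E (hX : ContinuousOn X (Ici 0)) (hn : skNormal D X M) {a : Euc d} {r : ℝ} (hr : 0 ≤ r)
    (hball : ∀ u : Euc d, ‖u‖ ≤ r → a + u ∈ closure D) (s t : ℝ) (hs : 0 ≤ s) (hst : s ≤ t) :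
    r * ‖φ t - φ s‖ ≤ M.pairing (fun τ => a - X τ) s t := by
  set v := φ t - φ s with hv
  set u : Euc d := -((r / ‖v‖) • v) with hu
  have hun : ‖u‖ ≤ r := by
    rw [hu, norm_neg, norm_smul, norm_div, norm_norm, Real.norm_of_nonneg hr]
    by_cases h : ‖v‖ = 0
    · simp [h, hr]
    · rw [div_mul_cancel₀ _ h]
  have h := hn (fun _ => a + u) continuous_const (fun _ _ => hball u hun) s t hs hst
  have hXc := sk_cont_Icc (t := t) hX hs
  rw [sk_split M (fun τ => a + u - X τ) u s t hs hst (continuousOn_const.sub hXc)] at h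
  have e : (fun τ => a + u - X τ - u) = fun τ => a - X τ := by
    funext τ; abel
  rw [e, ← hv] at h
  have e2 : inner ℝ u v = - (r * ‖v‖) := by
    rw [hu, inner_neg_left, real_inner_smul_left, real_inner_self_eq_norm_sq]
    by_cases h : ‖v‖ = 0
    · simp [h]
    · field_simp
  rw [e2] at h
  linarith

lemma sk_E2 (hX : ContinuousOn X (Ici 0)) (hn : skNormal D X M) {a : Euc d} {r : ℝ} (hr : 0 < r)
    (hball : ∀ u : Euc d, ‖u‖ ≤ r → a + u ∈ closure D) (s t : ℝ) (hs : 0 ≤ s) (hst : s ≤ t) :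
    r * skV φ s t ≤ M.pairing (fun τ => a - X τ) s t := by
  set f : ℝ → Euc d := fun τ => a - X τ with hf
  have hfc : ContinuousOn f (Ici 0) := continuousOn_const.sub hX
  have hE := sk_E hX hn hr.le hball
  have hnn : ∀ s t, 0 ≤ s → s ≤ t → 0 ≤ M.pairing f s t := fun s t h1 h2 =>
    le_trans (by positivity) (hE s t h1 h2)
  have key : eVariationOn φ (Icc s t) ≤ ENNReal.ofReal (M.pairing f s t / r) := by
    unfold eVariationOn
    refine iSup_le ?_
    rintro ⟨n, u, hu, hmem⟩
    have h0 : ∀ i, 0 ≤ u i := fun i => hs.trans (hmem i).1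
    have ind : ∀ n : ℕ, r * ∑ i ∈ Finset.range n, dist (φ (u (i + 1))) (φ (u i)) ≤
        M.pairing f (u 0) (u n) := by
      intro n
      induction n with
      | zero => simpa using hnn (u 0) (u 0) (h0 0) le_rfl
      | succ k ih =>
        rw [Finset.sum_range_succ, mul_add, sk_pairing_interval M f (u 0) (u k) (u (k+1)) (h0 0)
          (hu (Nat.zero_le _)) (hu (Nat.le_succ _)) (sk_cont_Icc hfc (h0 0)), dist_eq_norm]
        exact add_le_add ih (hE _ _ (h0 k) (hu (Nat.le_succ _)))
    have e1 := sk_pairing_interval M f s (u 0) t hs (hmem 0).1 (hmem 0).2 (sk_cont_Icc hfc hs)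
    have e2 := sk_pairing_interval M f (u 0) (u n) t (h0 0) (hu (Nat.zero_le _)) (hmem n).2
      (sk_cont_Icc hfc (h0 0))
    have h1 := hnn s (u 0) hs (hmem 0).1
    have h2 := hnn (u n) t (h0 n) (hmem n).2
    simp only [edist_dist]
    rw [← ENNReal.ofReal_sum_of_nonneg (fun _ _ => dist_nonneg)]
    refine ENNReal.ofReal_le_ofReal ?_
    rw [le_div_iff₀ hr]
    have := ind n
    linarith
  have := ENNReal.toReal_mono ENNReal.ofReal_ne_top key
  rw [ENNReal.toReal_ofReal (div_nonneg (hnn s t hs hst) hr.le)] at this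
  rw [mul_comm, ← le_div_iff₀ hr]
  exact this

lemma sk_local (hbv : skBV φ) (hX : ContinuousOn X (Ici 0)) (hn : skNormal D X M)
    {a c : Euc d} {r ρ : ℝ} (hr : 0 < r)
    (hball : ∀ u : Euc d, ‖u‖ ≤ r → a + u ∈ closure D) (s t : ℝ) (hs : 0 ≤ s) (hst : s ≤ t)
    (hosc : ∀ τ ∈ Icc s t, ‖c - X τ‖ ≤ ρ) :
    (r - ρ) * skV φ s t ≤ ‖a - c‖ * ‖φ t - φ s‖ := by
  have h1 := sk_E2 hX hn hr hball s t hs hst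
  have hXc := sk_cont_Icc (t := t) hX hs
  rw [sk_split M (fun τ => a - X τ) (a - c) s t hs hst (continuousOn_const.sub hXc)] at h1
  have e : (fun τ => a - X τ - (a - c)) = fun τ => c - X τ := by
    funext τ; abel
  rw [e] at h1
  have h2 := (le_abs_self _).trans (sk_bound M hbv (fun τ => c - X τ) s t ρ hs hst
    (continuousOn_const.sub hXc) hosc)
  have h3 := real_inner_le_norm (a - c) (φ t - φ s)
  linarith

end est

lemma sk_rc_meas (Y : ℝ → ℝ) (h : ∀ t, ContinuousWithinAt Y (Ici t) t) : Measurable Y := by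
  refine measurable_of_tendsto_metrizable
    (f := fun (n : ℕ) (t : ℝ) => Y ((⌊((n : ℝ) + 1) * t⌋ + 1) / ((n : ℝ) + 1))) ?_ ?_
  · intro n
    have h1 : Measurable fun k : ℤ => Y (((k : ℝ) + 1) / ((n : ℝ) + 1)) := measurable_of_countable _
    have h2 : Measurable fun t : ℝ => ⌊((n : ℝ) + 1) * t⌋ := by fun_prop
    exact h1.comp h2
  · rw [tendsto_pi_nhds]
    intro t
    have hb : ∀ n : ℕ, t ≤ ((⌊((n : ℝ) + 1) * t⌋ + 1) / ((n : ℝ) + 1)) ∧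
        ((⌊((n : ℝ) + 1) * t⌋ + 1) / ((n : ℝ) + 1)) ≤ t + 1 / ((n : ℝ) + 1) := by
      intro n
      have hp : (0 : ℝ) < (n : ℝ) + 1 := by positivity
      have h1 := Int.floor_le (((n : ℝ) + 1) * t)
      have h2 := Int.lt_floor_add_one (((n : ℝ) + 1) * t)
      constructor
      · rw [le_div_iff₀ hp]; linarith
      · rw [div_le_iff₀ hp]
        have e : (t + 1 / ((n : ℝ) + 1)) * ((n : ℝ) + 1) = ((n : ℝ) + 1) * t + 1 := by
          field_simp
        rw [e]; linarith
    refine (h t).tendsto.comp (tendsto_nhdsWithin_iff.2 ⟨?_, Eventually.of_forall fun n => (hb n).1⟩)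
    refine tendsto_of_tendsto_of_tendsto_of_le_of_le tendsto_const_nhds ?_ (fun n => (hb n).1)
      (fun n => (hb n).2)
    simpa using tendsto_const_nhds.add (tendsto_one_div_add_atTop_nhds_zero_nat (𝕜 := ℝ))

lemma sk_shrink (μ : Measure ℝ) (g : ℝ → ℝ) (u : ℕ → ℝ) (t : ℝ) (hu : Monotone u)
    (hut : ∀ n, u n < t) (hlim : Tendsto u atTop (𝓝 t)) (hg : IntegrableOn g (Ioc (u 0) t) μ) :
    Tendsto (fun n => ∫ τ in Ioc (u n) t, g τ ∂μ) atTop (𝓝 (μ.real {t} * g t)) := by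
  have h := tendsto_setIntegral_of_antitone (μ := μ) (f := g) (s := fun n => Ioc (u n) t)
    (fun _ => measurableSet_Ioc) (fun m n hmn => Ioc_subset_Ioc_left (hu hmn)) ⟨0, hg⟩
  have e : (⋂ n, Ioc (u n) t) = {t} := by
    ext x
    simp only [mem_iInter, mem_Ioc, mem_singleton_iff]
    constructor
    · intro hx
      refine le_antisymm (hx 0).2 ?_
      exact le_of_tendsto' hlim fun n => (hx n).1.le
    · rintro rfl n
      exact ⟨hut n, le_rfl⟩
  rw [e, integral_singleton, smul_eq_mul] at h
  exact h

lemma sk_continuous {d : ℕ} {D : Set (Euc d)} {w X φ : ℝ → Euc d} {M : BVMeasureData d φ}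
    (hw : ContinuousOn w (Ici 0)) (hsol : IsSkorohodSolution D w X φ M) :
    ContinuousOn X (Ici 0) := by
  intro t ht
  rcases eq_or_lt_of_le (show (0:ℝ) ≤ t from ht) with rfl | ht0
  · exact hsol.rightCont 0 le_rfl
  obtain ⟨L, hL⟩ := hsol.leftLim t ht0
  suffices hLX : L = X t by
    subst hLX
    refine ContinuousAt.continuousWithinAt ?_
    rw [continuousAt_iff_continuous_left'_right']
    exact ⟨hL, (hsol.rightCont t ht).mono Ioi_subset_Ici_self⟩
  have hLD : L ∈ closure D := by
    refine isClosed_closure.mem_of_tendsto hL ?_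
    filter_upwards [Ioo_mem_nhdsLT ht0] with τ hτ
    exact hsol.mem τ hτ.1.le
  have hev : ∀ᶠ τ in 𝓝[<] t, dist (X τ) L < 1 ∧ 0 < τ := by
    filter_upwards [hL (Metric.ball_mem_nhds L one_pos), Ioo_mem_nhdsLT ht0] with τ h1 h2
    exact ⟨h1, h2.1⟩
  obtain ⟨s0, hs0, hsub⟩ := (mem_nhdsLT_iff_exists_Ioo_subset).1 hev
  have hs0 : s0 < t := hs0
  obtain ⟨u, hu, humem, hlim⟩ := exists_seq_strictMono_tendsto' hs0
  have hu0 : ∀ n, 0 < u n := fun n => (hsub (humem n)).2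
  have hut : ∀ n, u n < t := fun n => (humem n).2
  have hlim' : Tendsto u atTop (𝓝[<] t) :=
    tendsto_nhdsWithin_iff.2 ⟨hlim, Eventually.of_forall hut⟩
  have hbd : ∀ τ ∈ Ioc (u 0) t, ‖L - X τ‖ ≤ max 1 ‖L - X t‖ := by
    intro τ hτ
    rcases eq_or_lt_of_le hτ.2 with rfl | h
    · exact le_max_right _ _
    · refine le_max_of_le_left ?_
      have := (hsub ⟨(humem 0).1.trans hτ.1, h⟩).1
      rw [dist_comm, dist_eq_norm] at this
      exact this.le
  have hmeas : ∀ i, Measurable fun τ => X (max τ 0) i := by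
    intro i
    refine sk_rc_meas _ fun τ => ?_
    have h1 : ContinuousWithinAt (fun τ => X (max τ 0)) (Ici τ) τ := by
      refine ContinuousWithinAt.comp (t := Ici (max τ 0)) (f := fun τ => max τ 0) (g := X)
        (hsol.rightCont (max τ 0) (le_max_right _ _)) ?_ ?_
      · exact (continuous_id.max continuous_const).continuousWithinAt
      · intro x hx
        exact max_le_max_right 0 (mem_Ici.1 hx)
    exact ((EuclideanSpace.proj (𝕜 := ℝ) i).continuous.tendsto _).comp h1
  have hint : ∀ (μ : Measure ℝ), (∀ t, μ (Icc 0 t) < ⊤) → ∀ i,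
      IntegrableOn (fun τ => (L - X τ) i) (Ioc (u 0) t) μ := by
    intro μ hμ i
    refine IntegrableOn.of_bound (sk_fin_Ioc μ hμ _ _ (hu0 0).le) ?_ (max 1 ‖L - X t‖) ?_
    · refine AEStronglyMeasurable.congr (f := fun τ => L i - X (max τ 0) i) ?_ ?_
      · exact (measurable_const.sub (hmeas i)).aestronglyMeasurable
      · refine (ae_restrict_iff' measurableSet_Ioc).2 (Eventually.of_forall fun τ hτ => ?_)
        simp only [PiLp.sub_apply]
        rw [max_eq_left ((hu0 0).trans hτ.1).le]
    · refine (ae_restrict_iff' measurableSet_Ioc).2 (Eventually.of_forall fun τ hτ => ?_)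
      exact (PiLp.norm_apply_le (L - X τ) i).trans (hbd τ hτ)
  have hpair : Tendsto (fun n => M.pairing (fun τ => L - X τ) (u n) t) atTop
      (𝓝 (∑ i, ((M.pos i).real {t} * (L - X t) i - (M.neg i).real {t} * (L - X t) i))) := by
    unfold BVMeasureData.pairing
    refine tendsto_finsetSum _ fun i _ => ?_
    exact (sk_shrink _ _ u t hu.monotone hut hlim (hint _ (M.pos_fin i) i)).sub
      (sk_shrink _ _ u t hu.monotone hut hlim (hint _ (M.neg_fin i) i))
  have hjump : ∀ i, (M.pos i).real {t} - (M.neg i).real {t} = (X t - L) i := by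
    intro i
    have one : ∀ (μ : Measure ℝ), (∀ t, μ (Icc 0 t) < ⊤) →
        Tendsto (fun n => (μ (Ioc (u n) t)).toReal) atTop (𝓝 (μ.real {t})) := by
      intro μ hμ
      have := sk_shrink μ (fun _ => 1) u t hu.monotone hut hlim
        (sk_integrable μ hμ _ _ _ (hu0 0).le continuousOn_const)
      simpa [setIntegral_const, Measure.real] using this
    have h1 := (one _ (M.pos_fin i)).sub (one _ (M.neg_fin i))
    have hwt : Tendsto (fun n => w (u n)) atTop (𝓝 (w t)) := by
      refine (hw t ht).tendsto.comp (tendsto_nhdsWithin_iff.2 ⟨hlim, ?_⟩)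
      exact Eventually.of_forall fun n => (hu0 n).le
    have h2 : Tendsto (fun n => (X t - w t) - (X (u n) - w (u n))) atTop
        (𝓝 ((X t - w t) - (L - w t))) :=
      tendsto_const_nhds.sub ((hL.comp hlim').sub hwt)
    have h3 : Tendsto (fun n => ((X t - w t) - (X (u n) - w (u n))) i) atTop
        (𝓝 (((X t - w t) - (L - w t)) i)) :=
      ((EuclideanSpace.proj (𝕜 := ℝ) i).continuous.tendsto _).comp h2
    have h4 : (fun n => ((X t - w t) - (X (u n) - w (u n))) i) =
        fun n => ((M.pos i) (Ioc (u n) t)).toReal - ((M.neg i) (Ioc (u n) t)).toReal := by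
      funext n
      rw [M.increments i (u n) t (hu0 n).le (hut n).le, hsol.eqn t ht, hsol.eqn (u n) (hu0 n).le]
      simp
    rw [h4] at h3
    rw [tendsto_nhds_unique h1 h3]
    simp
  have hge := ge_of_tendsto' hpair fun n =>
    hsol.assoc.normal (fun _ => L) continuous_const (fun _ _ => hLD) (u n) t (hu0 n).le (hut n).le
  have e : ∑ i, ((M.pos i).real {t} * (L - X t) i - (M.neg i).real {t} * (L - X t) i)
      = - ‖X t - L‖ ^ 2 := by
    rw [EuclideanSpace.real_norm_sq_eq, ← Finset.sum_neg_distrib]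
    refine Finset.sum_congr rfl fun i _ => ?_
    rw [← sub_mul, hjump i]
    simp only [PiLp.sub_apply]
    ring
  rw [e] at hge
  have h0 : ‖X t - L‖ = 0 := by
    have := norm_nonneg (X t - L)
    nlinarith
  exact (sub_eq_zero.1 (norm_eq_zero.1 h0)).symm

lemma sk_build {d : ℕ} (φ : ℝ → Euc d) (hc : ContinuousOn φ (Ici 0)) (hbv : skBV φ) :
    ∃ M : BVMeasureData d φ, M.var {0} = 0 := by
  set ψ : ℝ → Euc d := fun t => φ (max t 0) with hψ
  have hψc : Continuous ψ :=
    hc.comp_continuous (continuous_id.max continuous_const) fun t => mem_Ici.2 (le_max_right _ _)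
  have hψφ : ∀ t, 0 ≤ t → ψ t = φ t := fun t ht => by simp [hψ, ht]
  have hψbv : LocallyBoundedVariationOn ψ univ := by
    intro a b _ _
    have h1 : eVariationOn ψ (univ ∩ Icc a b) ≤ eVariationOn φ (Icc 0 (max b 0)) := by
      refine eVariationOn.comp_le_of_monotoneOn φ (fun t => max t 0) ?_ ?_
      · intro x _ y _ hxy
        exact max_le_max_right 0 hxy
      · rintro x ⟨_, hx⟩
        exact ⟨le_max_right _ _, max_le_max_right 0 hx.2⟩
    exact (lt_of_le_of_lt h1 (hbv _ (le_max_right _ _))).ne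
  set v : ℝ → ℝ := variationOnFromTo ψ univ 0 with hv
  have hvmono : Monotone v := by
    rw [← monotoneOn_univ]
    exact variationOnFromTo.monotoneOn hψbv (mem_univ _)
  have hvdiff : ∀ s t, s ≤ t → v t - v s = (eVariationOn ψ (Icc s t)).toReal := by
    intro s t hst
    rw [hv, variationOnFromTo.sub_right hψbv (mem_univ _) (mem_univ _) (mem_univ _),
      variationOnFromTo.eq_of_le _ _ hst, univ_inter]
  have hvrc : ∀ x, ContinuousWithinAt v (Ici x) x := by
    intro x
    rw [← continuousWithinAt_Ioi_iff_Ici]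
    have := variationOnFromTo.tendsto_right (a := 0) (b := x) (mem_univ _) (mem_univ _) hψbv
      (l := ψ x) (hψc.continuousAt.tendsto.mono_left nhdsWithin_le_nhds)
    simpa [ContinuousWithinAt] using this
  have hvlc : Tendsto v (𝓝[<] 0) (𝓝 (v 0)) := by
    have := variationOnFromTo.tendsto_left (a := 0) (b := 0) (mem_univ _) (mem_univ _) hψbv
      (l := ψ 0) (hψc.continuousAt.tendsto.mono_left nhdsWithin_le_nhds)
    simpa using this
  let F : StieltjesFunction ℝ := ⟨v, hvmono, hvrc⟩
  have hdist : ∀ (i : Fin d) s t, s ≤ t → ψ t i - ψ s i ≤ v t - v s := by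
    intro i s t hst
    rw [hvdiff s t hst]
    have hfin : BoundedVariationOn ψ (Icc s t) := by
      have := hψbv s t (mem_univ _) (mem_univ _)
      rwa [univ_inter] at this
    have h1 := hfin.dist_le (right_mem_Icc.2 hst) (left_mem_Icc.2 hst)
    rw [dist_eq_norm] at h1
    refine le_trans ?_ h1
    refine le_trans ?_ (PiLp.norm_apply_le (ψ t - ψ s) i)
    rw [Real.norm_eq_abs]
    exact le_abs_self _
  have hψi : ∀ i : Fin d, Continuous fun t => ψ t i := fun i =>
    (EuclideanSpace.proj (𝕜 := ℝ) i).continuous.comp hψc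
  let G : Fin d → StieltjesFunction ℝ := fun i => ⟨fun t => v t - ψ t i,
    fun s t hst => by have := hdist i s t hst; simp only; linarith,
    fun x => (hvrc x).sub (hψi i).continuousWithinAt⟩
  have hF : ∀ s t, F.measure (Ioc s t) = ENNReal.ofReal (v t - v s) := fun s t => F.measure_Ioc s t
  have hG : ∀ i s t, (G i).measure (Ioc s t) =
      ENNReal.ofReal ((v t - ψ t i) - (v s - ψ s i)) := fun i s t => (G i).measure_Ioc s t
  refine ⟨⟨fun _ => F.measure, fun i => (G i).measure, F.measure, ?_, ?_, ?_, ?_⟩, ?_⟩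
  · intro i t; exact isCompact_Icc.measure_lt_top
  · intro i t; exact isCompact_Icc.measure_lt_top
  · intro i s t hs hst
    have h1 := hdist i s t hst
    rw [hF, hG, ENNReal.toReal_ofReal (by have := hvmono hst; linarith),
      ENNReal.toReal_ofReal (by linarith), ← hψφ s hs, ← hψφ t (hs.trans hst)]
    ring
  · intro s t hs hst
    rw [hF, hvdiff s t hst]
    have e : eVariationOn ψ (Icc s t) = eVariationOn φ (Icc s t) :=
      eVariationOn.congr fun x hx => hψφ x (hs.trans hx.1)
    rw [e, ENNReal.ofReal_toReal (hbv.fin s t hs hst).ne]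
  · show F.measure {0} = 0
    rw [StieltjesFunction.measure_singleton]
    have e : Function.leftLim F 0 = v 0 := leftLim_eq_of_tendsto hvlc
    rw [e]
    have e2 : F 0 = v 0 := rfl
    simp [e2]

section lim

variable {d : ℕ} {φ : ℕ → ℝ → Euc d} {ψ : ℝ → Euc d}

lemma sk_conv (M : ∀ n, BVMeasureData d (φ n)) (N : BVMeasureData d ψ)
    (hbv : ∀ n, skBV (φ n)) (hbvl : skBV ψ)
    (hlim : ∀ t, 0 ≤ t → Tendsto (fun n => φ n t) atTop (𝓝 (ψ t)))
    (f : ℝ → Euc d) (s t C : ℝ) (hs : 0 ≤ s) (hst : s ≤ t) (hf : ContinuousOn f (Icc s t))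
    (hC : ∀ᶠ n in atTop, skV (φ n) s t ≤ C) :
    Tendsto (fun n => (M n).pairing f s t) atTop (𝓝 (N.pairing f s t)) := by
  have key : ∀ ε > 0, ∃ e : ℕ → ℝ, Tendsto e atTop (𝓝 0) ∧ ∀ n,
      |(M n).pairing f s t - N.pairing f s t| ≤ ε * (skV (φ n) s t + skV ψ s t) + e n := by
    intro ε hε
    obtain ⟨δ, hδ, hu⟩ := sk_unif hf hε
    refine sk_chain (fun a b => ∃ e : ℕ → ℝ, Tendsto e atTop (𝓝 0) ∧ ∀ n,
      |(M n).pairing f a b - N.pairing f a b| ≤ ε * (skV (φ n) a b + skV ψ a b) + e n)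
      s t δ hδ hst ?_ ?_
    · intro a b ha hab hb hd
      have ha0 := hs.trans ha
      have hb0 := ha0.trans hab
      have hfab : ContinuousOn f (Icc a b) := hf.mono (Icc_subset_Icc ha hb)
      refine ⟨fun n => |inner ℝ (f b) ((φ n b - φ n a) - (ψ b - ψ a))|, ?_, fun n => ?_⟩
      · have h1 : Tendsto (fun n => (φ n b - φ n a) - (ψ b - ψ a)) atTop (𝓝 0) := by
          have := ((hlim b hb0).sub (hlim a ha0)).sub_const (ψ b - ψ a)
          rwa [sub_self] at this
        have h2 := ((tendsto_const_nhds (x := f b)).inner (𝕜 := ℝ) h1).abs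
        simpa using h2
      · have hosc : ∀ τ ∈ Icc a b, ‖f τ - f b‖ ≤ ε := fun τ hτ =>
          hu a b ha hab hb hd τ hτ b (right_mem_Icc.2 hab)
        have h1 := sk_bound (M n) (hbv n) (fun τ => f τ - f b) a b ε ha0 hab
          (hfab.sub continuousOn_const) hosc
        have h2 := sk_bound N hbvl (fun τ => f τ - f b) a b ε ha0 hab
          (hfab.sub continuousOn_const) hosc
        beta_reduce
        rw [sk_split (M n) f (f b) a b ha0 hab hfab, sk_split N f (f b) a b ha0 hab hfab,
          inner_sub_right (f b) (φ n b - φ n a)]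
        rw [abs_le] at h1 h2
        have h3 := le_abs_self (inner ℝ (f b) (φ n b - φ n a) - inner ℝ (f b) (ψ b - ψ a))
        have h4 := neg_abs_le (inner ℝ (f b) (φ n b - φ n a) - inner ℝ (f b) (ψ b - ψ a))
        rw [abs_le]
        constructor <;> linarith [h1.1, h1.2, h2.1, h2.2]
    · rintro a b c ha hab hbc hc ⟨e1, he1, h1⟩ ⟨e2, he2, h2⟩
      have ha0 := hs.trans ha
      have hfac := hf.mono (Icc_subset_Icc ha hc)
      refine ⟨fun n => e1 n + e2 n, by simpa using he1.add he2, fun n => ?_⟩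
      rw [sk_pairing_interval (M n) f a b c ha0 hab hbc hfac,
        sk_pairing_interval N f a b c ha0 hab hbc hfac,
        skV_add (hbv n) a b c ha0 hab hbc, skV_add hbvl a b c ha0 hab hbc]
      have h1 := abs_le.1 (h1 n)
      have h2 := abs_le.1 (h2 n)
      rw [abs_le]
      constructor <;> linarith [h1.1, h1.2, h2.1, h2.2]
  rw [tendsto_iff_norm_sub_tendsto_zero, Metric.tendsto_nhds]
  intro ε hε
  set K := |C| + skV ψ s t + 1 with hK
  have hVn := skV_nonneg ψ s t
  have hK0 : 0 < K := by positivity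
  obtain ⟨e, he, h⟩ := key (ε / (2 * K)) (by positivity)
  filter_upwards [hC, he.eventually (gt_mem_nhds (show (0:ℝ) < ε / 2 by positivity))] with n h1 h2
  rw [dist_zero_right, norm_norm, Real.norm_eq_abs]
  refine lt_of_le_of_lt (h n) ?_
  have h3 : skV (φ n) s t + skV ψ s t ≤ K := by
    have := le_abs_self C
    linarith
  have h4 : ε / (2 * K) * (skV (φ n) s t + skV ψ s t) ≤ ε / (2 * K) * K :=
    mul_le_mul_of_nonneg_left h3 (by positivity)
  have h5 : ε / (2 * K) * K = ε / 2 := by field_simp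
  linarith

lemma sk_lsc (hbv : ∀ n, skBV (φ n))
    (hlim : ∀ t, 0 ≤ t → Tendsto (fun n => φ n t) atTop (𝓝 (ψ t)))
    (s t C : ℝ) (hs : 0 ≤ s) (hst : s ≤ t)
    (hC : ∀ᶠ n in atTop, skV (φ n) s t ≤ C) : eVariationOn ψ (Icc s t) < ⊤ := by
  refine lt_of_le_of_lt (b := ENNReal.ofReal C) ?_ ENNReal.ofReal_lt_top
  by_contra hcon
  push Not at hcon
  have h := eVariationOn.lowerSemicontinuous_aux (F := φ) (p := atTop) (f := ψ) (s := Icc s t)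
    (fun x hx => hlim x (hs.trans hx.1)) hcon
  obtain ⟨n, h1, h2⟩ := (h.and hC).exists
  refine absurd h1 (not_lt.2 ?_)
  rw [← ENNReal.ofReal_toReal ((hbv n).fin s t hs hst).ne]
  exact ENNReal.ofReal_le_ofReal h2

end lim

/-- **Theorem 4.1.8.** Let `D ⊆ ℝ^d` be a nonempty convex open set, and let `wₙ` be
continuous with `wₙ(0) ∈ closure D` such that `Xₙ = wₙ + φₙ` has a solution for each `n`.
If `wₙ → w` and `Xₙ → X` uniformly on compact subsets of `[0,∞)`, where `w` is continuous
with `w(0) ∈ closure D`, then `(X, φ)` with `φ = X − w` solves the Skorohod equation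
`X = w + φ`. -/
theorem skorohod_solution_stability {d : ℕ} (D : Set (Euc d)) (hne : D.Nonempty)
    (hconv : Convex ℝ D) (hopen : IsOpen D)
    (w : ℕ → ℝ → Euc d) (X : ℕ → ℝ → Euc d) (φ : ℕ → ℝ → Euc d)
    (M : ∀ n : ℕ, BVMeasureData d (φ n))
    (hw_cont : ∀ n, ContinuousOn (w n) (Ici 0)) (hw0 : ∀ n, w n 0 ∈ closure D)
    (hsol : ∀ n, IsSkorohodSolution D (w n) (X n) (φ n) (M n))
    (wlim : ℝ → Euc d) (Xlim : ℝ → Euc d)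
    (hwlim_cont : ContinuousOn wlim (Ici 0)) (hwlim0 : wlim 0 ∈ closure D)
    (hw_unif : ∀ T : ℝ, 0 < T → TendstoUniformlyOn w wlim atTop (Icc 0 T))
    (hX_unif : ∀ T : ℝ, 0 < T → TendstoUniformlyOn X Xlim atTop (Icc 0 T)) :
    ∃ Mlim : BVMeasureData d (fun t => Xlim t - wlim t),
      IsSkorohodSolution D wlim Xlim (fun t => Xlim t - wlim t) Mlim := by
  have hXc : ∀ n, ContinuousOn (X n) (Ici 0) := fun n => sk_continuous (hw_cont n) (hsol n)
  have hXlc : ContinuousOn Xlim (Ici 0) := by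
    intro t ht
    have ht : (0:ℝ) ≤ t := ht
    have h1 : ContinuousOn Xlim (Icc 0 (t + 1)) :=
      (hX_unif (t + 1) (by linarith)).continuousOn
        (Frequently.of_forall fun n => (hXc n).mono fun x hx => hx.1)
    refine (h1 t ⟨ht, by linarith⟩).mono_of_mem_nhdsWithin ?_
    rw [mem_nhdsWithin_iff_exists_mem_nhds_inter]
    exact ⟨Iic (t + 1), Iic_mem_nhds (by linarith), fun x hx => ⟨hx.2, hx.1⟩⟩
  have hXp : ∀ t, 0 ≤ t → Tendsto (fun n => X n t) atTop (𝓝 (Xlim t)) := fun t ht =>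
    (hX_unif (t + 1) (by linarith)).tendsto_at ⟨ht, by linarith⟩
  have hwp : ∀ t, 0 ≤ t → Tendsto (fun n => w n t) atTop (𝓝 (wlim t)) := fun t ht =>
    (hw_unif (t + 1) (by linarith)).tendsto_at ⟨ht, by linarith⟩
  have hφe : ∀ n t, 0 ≤ t → φ n t = X n t - w n t := fun n t ht => by
    rw [(hsol n).eqn t ht]; abel
  set ψ : ℝ → Euc d := fun t => Xlim t - wlim t with hψ
  have hφp : ∀ t, 0 ≤ t → Tendsto (fun n => φ n t) atTop (𝓝 (ψ t)) := fun t ht => by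
    simp only [hφe _ t ht]
    exact (hXp t ht).sub (hwp t ht)
  have hψc : ContinuousOn ψ (Ici 0) := hXlc.sub hwlim_cont
  have hbv : ∀ n, skBV (φ n) := fun n => (hsol n).assoc.bv
  have hnorm : ∀ n, skNormal D (X n) (M n) := fun n => (hsol n).assoc.normal
  -- balls inside the closed domain
  have hballs : ∀ a ∈ D, ∃ r > 0, ∀ u : Euc d, ‖u‖ ≤ r → a + u ∈ closure D := by
    intro a ha
    obtain ⟨r, hr, hsub⟩ := Metric.isOpen_iff.1 hopen a ha
    refine ⟨r / 2, by positivity, fun u hu => subset_closure (hsub ?_)⟩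
    rw [Metric.mem_ball, dist_eq_norm, add_sub_cancel_left]
    linarith
  obtain ⟨a, ha⟩ := hne
  obtain ⟨r, hr, hball⟩ := hballs a ha
  have hclose : ∀ T ε : ℝ, 0 ≤ T → 0 < ε → ∀ᶠ n in atTop, ∀ τ ∈ Icc 0 T, ‖Xlim τ - X n τ‖ ≤ ε := by
    intro T ε hT hε
    filter_upwards [Metric.tendstoUniformlyOn_iff.1 (hX_unif (T + 1) (by linarith)) ε hε] with n hn
    intro τ hτ
    rw [← dist_eq_norm]
    exact (hn τ ⟨hτ.1, by linarith [hτ.2]⟩).le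
  -- uniform bound for the variations
  have hVb : ∀ s t, 0 ≤ s → s ≤ t → ∃ C : ℝ, 0 ≤ C ∧ ∀ᶠ n in atTop, skV (φ n) s t ≤ C := by
    intro s t hs hst
    obtain ⟨δ, hδ, hu⟩ := sk_unif (sk_cont_Icc (t := t) hXlc hs) (show 0 < r / 8 by positivity)
    refine sk_chain (fun s t => ∃ C : ℝ, 0 ≤ C ∧ ∀ᶠ n in atTop, skV (φ n) s t ≤ C) s t δ hδ hst ?_ ?_
    · intro b c hb hbc hc hd
      have hb0 := hs.trans hb
      have hlim : Tendsto (fun n => ‖a - X n b‖ * ‖φ n c - φ n b‖) atTop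
          (𝓝 (‖a - Xlim b‖ * ‖ψ c - ψ b‖)) :=
        ((hXp b hb0).const_sub a).norm.mul ((hφp c (hb0.trans hbc)).sub (hφp b hb0)).norm
      set B := ‖a - Xlim b‖ * ‖ψ c - ψ b‖ with hB
      have hB0 : 0 ≤ B := by positivity
      refine ⟨(B + 1) / (r / 2), by positivity, ?_⟩
      filter_upwards [hclose t (r / 8) (hs.trans hst) (by positivity),
        hlim.eventually (gt_mem_nhds (lt_add_one B))] with n h1 h2
      have hosc : ∀ τ ∈ Icc b c, ‖X n b - X n τ‖ ≤ r / 2 := by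
        intro τ hτ
        have e : X n b - X n τ = -(Xlim b - X n b) + (Xlim b - Xlim τ) + (Xlim τ - X n τ) := by
          abel
        rw [e]
        have g1 := h1 b ⟨hb0, hbc.trans hc⟩
        have g2 := h1 τ ⟨hb0.trans hτ.1, hτ.2.trans hc⟩
        have g3 := hu b c hb hbc hc hd b (left_mem_Icc.2 hbc) τ hτ
        refine (norm_add₃_le).trans ?_
        rw [norm_neg]
        linarith
      have h3 := sk_local (hbv n) (hXc n) (hnorm n) hr hball b c hb0 hbc hosc
      rw [le_div_iff₀ (by positivity)]
      have e : r - r / 2 = r / 2 := by ring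
      rw [e] at h3
      linarith
    · rintro b c e hb hbc hce he ⟨C1, hC1, h1⟩ ⟨C2, hC2, h2⟩
      refine ⟨C1 + C2, by positivity, ?_⟩
      filter_upwards [h1, h2] with n g1 g2
      rw [skV_add (hbv n) b c e (hs.trans hb) hbc hce]
      linarith
  have hψbv : skBV ψ := by
    intro t ht
    obtain ⟨C, _, hC⟩ := hVb 0 t le_rfl ht
    exact sk_lsc hbv hφp 0 t C le_rfl ht hC
  obtain ⟨N, hN0⟩ := sk_build ψ hψc hψbv
  have hN : skNormal D Xlim N := by
    intro η hη hηD s t hs hst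
    obtain ⟨C, hC0, hC⟩ := hVb s t hs hst
    have hfc : ContinuousOn (fun τ => η τ - Xlim τ) (Icc s t) :=
      hη.continuousOn.sub (sk_cont_Icc hXlc hs)
    have hconv := sk_conv M N hbv hψbv hφp (fun τ => η τ - Xlim τ) s t C hs hst hfc hC
    have key : ∀ ε > 0, -(ε * C) ≤ N.pairing (fun τ => η τ - Xlim τ) s t := by
      intro ε hε
      refine ge_of_tendsto hconv ?_
      filter_upwards [hC, hclose t ε (hs.trans hst) hε] with n h1 h2
      have h3 := hnorm n η hη hηD s t hs hst
      have hdc : ContinuousOn (fun τ => Xlim τ - X n τ) (Icc s t) :=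
        (sk_cont_Icc hXlc hs).sub (sk_cont_Icc (hXc n) hs)
      have e : (fun τ => η τ - X n τ) = fun τ => (η τ - Xlim τ) + (Xlim τ - X n τ) := by
        funext τ; abel
      rw [e, sk_pairing_add (M n) (fun τ => η τ - Xlim τ) (fun τ => Xlim τ - X n τ) s t hs
        hfc hdc] at h3
      have h4 := (le_abs_self _).trans (sk_bound (M n) (hbv n) (fun τ => Xlim τ - X n τ) s t ε hs
        hst hdc fun τ hτ => h2 τ ⟨hs.trans hτ.1, hτ.2⟩)
      have h5 : ε * skV (φ n) s t ≤ ε * C := mul_le_mul_of_nonneg_left h1 hε.le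
      linarith
    refine le_of_forall_pos_le_add fun ε hε => ?_
    have h1 := key (ε / (C + 1)) (by positivity)
    have h2 : ε / (C + 1) * C ≤ ε := by
      rw [div_mul_eq_mul_div, div_le_iff₀ (by positivity)]
      nlinarith
    linarith
  have hrc : ∀ f : ℝ → Euc d, ContinuousOn f (Ici 0) → RightContinuousOnNonneg f :=
    fun f hf t ht => (hf t ht).mono fun x hx => le_trans ht (mem_Ici.1 hx)
  have hll : ∀ f : ℝ → Euc d, ContinuousOn f (Ici 0) → HasLeftLimitsOnPos f :=
    fun f hf t ht => ⟨f t, (hf.continuousAt (Ici_mem_nhds ht)).tendsto.mono_left nhdsWithin_le_nhds⟩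
  refine ⟨N, hrc _ hXlc, hll _ hXlc, ?_, ?_, hrc _ hψc, hll _ hψc, hψbv, ?_, ?_, hN⟩
  · intro t ht
    exact isClosed_closure.mem_of_tendsto (hXp t ht)
      (Eventually.of_forall fun n => (hsol n).mem t ht)
  · intro t _
    simp [hψ]
  · refine tendsto_nhds_unique (hφp 0 le_rfl) ?_
    simp only [(hsol _).assoc.init]
    exact tendsto_const_nhds
  · refine measure_null_of_locally_null _ ?_
    rintro t ⟨ht, htD⟩
    obtain ⟨ρ, hρ, hρball⟩ := hballs _ htD
    obtain ⟨δ, hδ, hcl⟩ := Metric.continuousWithinAt_iff.1 (hXlc t ht) (ρ / 2) (by positivity)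
    set p := max 0 (t - δ / 2) with hp
    set q := t + δ / 2 with hq
    have hp0 : 0 ≤ p := le_max_left _ _
    have hpt : p ≤ t := max_le ht (by linarith)
    have hpq : p ≤ q := by linarith
    have hosc : ∀ τ ∈ Icc p q, ‖Xlim t - Xlim τ‖ ≤ ρ / 2 := by
      intro τ hτ
      rw [← dist_eq_norm, dist_comm]
      refine (hcl (hp0.trans hτ.1) ?_).le
      have h1 : t - δ / 2 ≤ τ := (le_max_right _ _).trans hτ.1
      have h2 := hτ.2
      rw [Real.dist_eq, abs_lt]
      constructor <;> linarith
    have hV := sk_local hψbv hXlc hN hρ hρball p q hp0 hpq hosc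
    rw [sub_self, norm_zero, zero_mul] at hV
    have hV0 : skV ψ p q = 0 := by
      have := skV_nonneg ψ p q
      nlinarith
    have hnull : N.var (Ioc p q) = 0 := by
      rw [N.var_eq p q hp0 hpq]
      unfold skV at hV0
      rw [ENNReal.toReal_eq_zero_iff] at hV0
      exact hV0.resolve_right (hψbv.fin p q hp0 hpq).ne
    refine ⟨{0} ∪ Ioc p q, ?_, measure_union_null hN0 hnull⟩
    rw [mem_nhdsWithin_iff_exists_mem_nhds_inter]
    refine ⟨Ioo (t - δ / 2) q, Ioo_mem_nhds (by linarith) (by linarith), ?_⟩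
    rintro x ⟨hx, hx0, _⟩
    rcases eq_or_lt_of_le hx0 with h | h
    · left; exact h.symm
    · right; exact ⟨max_lt h hx.1, hx.2.le⟩

end
end

section
/- Every nonempty convex open set D in ℝ² satisfies Condition B: there exist ε > 0 and δ > 0 such that for every x ∈ ∂D there exists x₀ ∈ ℝ² with the open ball B_ε(x₀) = {y : |y − x₀| < ε} contained in D and |x − x₀| ≤ δ. -/
open Set

lemma frame_aux (u z : EuclideanSpace ℝ (Fin 2)) (hu : ‖u‖ = 1) :
    ∃ w : EuclideanSpace ℝ (Fin 2), ‖w‖ = 1 ∧ 0 ≤ inner ℝ z w ∧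
      ∀ y : EuclideanSpace ℝ (Fin 2), y = (inner ℝ y u : ℝ) • u + (inner ℝ y w : ℝ) • w := by
  have h1 : u 0 ^ 2 + u 1 ^ 2 = 1 := by
    have := EuclideanSpace.real_norm_sq_eq u
    rw [hu, Fin.sum_univ_two] at this
    linarith
  have key : ∀ σ : ℝ, σ ^ 2 = 1 → 0 ≤ σ * (z 1 * u 0 - z 0 * u 1) →
      ∃ w : EuclideanSpace ℝ (Fin 2), ‖w‖ = 1 ∧ 0 ≤ inner ℝ z w ∧
      ∀ y : EuclideanSpace ℝ (Fin 2),
        y = (inner ℝ y u : ℝ) • u + (inner ℝ y w : ℝ) • w := by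
    intro σ hσ hz
    refine ⟨!₂[-σ * u 1, σ * u 0], ?_, ?_, ?_⟩
    · have h2 := EuclideanSpace.real_norm_sq_eq (!₂[-σ * u 1, σ * u 0])
      rw [Fin.sum_univ_two] at h2
      simp at h2
      have h3 : ‖!₂[-σ * u 1, σ * u 0]‖ ^ 2 = 1 := by
        simp only [neg_mul]
        rw [h2]
        linear_combination σ ^ 2 * h1 + hσ
      nlinarith [norm_nonneg (!₂[-σ * u 1, σ * u 0])]
    · simp only [PiLp.inner_apply, Fin.sum_univ_two]
      simp
      linarith
    · intro y
      ext i
      fin_cases i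
      · simp [PiLp.inner_apply, Fin.sum_univ_two]
        linear_combination (-y 0) * h1 + (- y 0 * u 1 ^ 2 + y 1 * u 0 * u 1) * (hσ)
      · simp [PiLp.inner_apply, Fin.sum_univ_two]
        linear_combination (-y 1) * h1 + (- y 1 * u 0 ^ 2 + y 0 * u 0 * u 1) * (hσ)
  rcases le_total 0 (z 1 * u 0 - z 0 * u 1) with h | h
  · exact key 1 (by norm_num) (by linarith)
  · exact key (-1) (by norm_num) (by linarith)

lemma geom_aux (C : Set (EuclideanSpace ℝ (Fin 2))) (hC : Convex ℝ C)
    (u p x : EuclideanSpace ℝ (Fin 2)) (r : ℝ) (hr : 0 < r) (hu : ‖u‖ = 1)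
    (hrec : ∀ d ∈ C, ∀ a : ℝ, 0 ≤ a → d + a • u ∈ C)
    (hp : Metric.ball p r ⊆ C) (hx : x ∈ C) (hs : 0 ≤ (inner ℝ (x - p) u : ℝ)) :
    ∃ x₀, Metric.ball x₀ (min r (1/2)) ⊆ C ∧ dist x x₀ ≤ 2 := by
  obtain ⟨w, hw, ht, hdec⟩ := frame_aux u (x - p) hu
  have hxp := hdec (x - p)
  set s : ℝ := inner ℝ (x - p) u
  set t : ℝ := inner ℝ (x - p) w
  have hx' : x = p + s • u + t • w := by
    rw [add_assoc, ← hxp]; abel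
  rcases lt_or_ge t 1 with h1 | h1
  · refine ⟨p + s • u, ?_, ?_⟩
    · intro y hy
      have : y - s • u ∈ Metric.ball p r := by
        rw [Metric.mem_ball, dist_eq_norm] at *
        have e : y - s • u - p = y - (p + s • u) := by abel
        rw [e]
        exact hy.trans_le (min_le_left _ _)
      simpa using hrec _ (hp this) s hs
    · rw [hx', dist_eq_norm, add_sub_cancel_left, norm_smul, hw, Real.norm_eq_abs,
        abs_of_nonneg ht]
      linarith
  · refine ⟨x + u - (1/2 : ℝ) • w, ?_, ?_⟩
    · intro y hy
      have hy' : ‖y - (x + u - (1/2 : ℝ) • w)‖ < 1/2 := by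
        rw [← dist_eq_norm]; exact (Metric.mem_ball.1 hy).trans_le (min_le_right _ _)
      have hd := hdec (y - (x + u - (1/2 : ℝ) • w))
      have ha := abs_real_inner_le_norm (y - (x + u - (1/2 : ℝ) • w)) u
      have hb := abs_real_inner_le_norm (y - (x + u - (1/2 : ℝ) • w)) w
      rw [hu, mul_one] at ha
      rw [hw, mul_one] at hb
      set α : ℝ := inner ℝ (y - (x + u - (1/2 : ℝ) • w)) u
      set β : ℝ := inner ℝ (y - (x + u - (1/2 : ℝ) • w)) w
      have ha' := abs_lt.1 (ha.trans_lt hy')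
      have hb' := abs_lt.1 (hb.trans_lt hy')
      have ht0 : 0 < t := by linarith
      have hl0 : 0 ≤ (1/2 - β) / t := div_nonneg (by linarith) ht0.le
      have hl1 : (1/2 - β) / t ≤ 1 := by rw [div_le_one ht0]; linarith
      have hlt : (1/2 - β) / t * t = 1/2 - β := by field_simp
      set l := (1/2 - β) / t
      have hq : (1 - l) • x + l • (p + s • u) ∈ C :=
        hC hx (hrec p (hp (Metric.mem_ball_self hr)) s hs) (by linarith) hl0 (by ring)
      have := hrec _ hq (1 + α) (by linarith)
      convert this using 1
      have e1 : y = (x + u - (1/2 : ℝ) • w) + (α • u + β • w) := by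
        rw [← hd]; abel
      have e2 : p + s • u = x - t • w := by rw [hx']; abel
      rw [e2, e1]
      have e3 : l • (x - t • w) = l • x - (1/2 - β) • w := by
        rw [smul_sub, smul_smul, hlt]
      rw [e3]
      module
    · rw [dist_eq_norm]
      have : x - (x + u - (1/2 : ℝ) • w) = (1/2 : ℝ) • w - u := by abel
      rw [this]
      refine (norm_sub_le _ _).trans ?_
      rw [norm_smul, hw, hu]
      norm_num

/-- Every nonempty convex open set `D ⊆ ℝ²` satisfies Condition B: there exist `ε > 0` and
`δ > 0` such that for every boundary point `x` of `D` there is `x₀` with `B_ε(x₀) ⊆ D`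
and `|x − x₀| ≤ δ`. -/
theorem conditionB_of_dim_two (D : Set (EuclideanSpace ℝ (Fin 2)))
    (hne : D.Nonempty) (hconv : Convex ℝ D) (hopen : IsOpen D) :
    ∃ ε : ℝ, 0 < ε ∧ ∃ δ : ℝ, 0 < δ ∧
      ∀ x ∈ frontier D, ∃ x₀ : EuclideanSpace ℝ (Fin 2),
        Metric.ball x₀ ε ⊆ D ∧ dist x x₀ ≤ δ := by
  obtain ⟨p, hpD⟩ := hne
  obtain ⟨r, hr, hball⟩ := Metric.isOpen_iff.1 hopen p hpD
  have hint : interior (closure D) = D := by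
    rw [hconv.interior_closure_eq_interior_of_nonempty_interior
      (by rw [hopen.interior_eq]; exact ⟨p, hpD⟩), hopen.interior_eq]
  refine ⟨min r (1/2), by positivity, ?_⟩
  by_contra! hcon
  have hcon' : ∀ n : ℕ, ∃ x ∈ frontier D, ∀ x₀ : EuclideanSpace ℝ (Fin 2),
      Metric.ball x₀ (min r (1/2)) ⊆ D → (n : ℝ) + 2 < dist x x₀ :=
    fun n => hcon (n + 2) (by positivity)
  choose x hxf hx using hcon'
  have hfar : ∀ n : ℕ, (n : ℝ) + 2 < ‖x n - p‖ := fun n => by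
    rw [← dist_eq_norm]
    exact hx n p ((Metric.ball_subset_ball (min_le_left _ _)).trans hball)
  have hpos : ∀ n : ℕ, 0 < ‖x n - p‖ := fun n =>
    lt_trans (by positivity) (hfar n)
  have hxC : ∀ n, x n ∈ closure D := fun n => frontier_subset_closure (hxf n)
  obtain ⟨u, hu, φ, hφ, hlim⟩ :=
    (isCompact_sphere (0 : EuclideanSpace ℝ (Fin 2)) 1).tendsto_subseq
      (x := fun n => (‖x n - p‖⁻¹ : ℝ) • (x n - p)) (fun n => by
        rw [mem_sphere_zero_iff_norm, norm_smul, norm_inv, norm_norm,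
          inv_mul_cancel₀ (hpos n).ne'])
  have hu1 : ‖u‖ = 1 := mem_sphere_zero_iff_norm.1 hu
  have hinf : Filter.Tendsto (fun n => ‖x n - p‖) Filter.atTop Filter.atTop :=
    Filter.tendsto_atTop_mono (fun n => by linarith [hfar n]) tendsto_natCast_atTop_atTop
  have hinv : Filter.Tendsto (fun n => ‖x (φ n) - p‖⁻¹) Filter.atTop (nhds 0) :=
    (tendsto_inv_atTop_zero.comp hinf).comp hφ.tendsto_atTop
  have hrec : ∀ d ∈ closure D, ∀ a : ℝ, 0 ≤ a → d + a • u ∈ closure D := by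
    intro d hd a ha
    have hL : Filter.Tendsto (fun n => d + a • ((‖x (φ n) - p‖⁻¹ : ℝ) • (x (φ n) - p))
        + (a * ‖x (φ n) - p‖⁻¹) • (p - d)) Filter.atTop
        (nhds (d + a • u + (a * 0) • (p - d))) :=
      ((hlim.const_smul a).const_add d).add ((hinv.const_mul a).smul_const (p - d))
    rw [mul_zero, zero_smul, add_zero] at hL
    refine isClosed_closure.mem_of_tendsto hL ?_
    have hev : ∀ᶠ n in Filter.atTop, a ≤ ‖x (φ n) - p‖ :=
      (hinf.comp hφ.tendsto_atTop).eventually_ge_atTop a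
    filter_upwards [hev] with n hn
    have h0 := hpos (φ n)
    have hc : a * ‖x (φ n) - p‖⁻¹ ≤ 1 := by
      rw [← div_eq_mul_inv, div_le_one h0]; exact hn
    have := hconv.closure hd (hxC (φ n)) (sub_nonneg.2 hc)
      (show 0 ≤ a * ‖x (φ n) - p‖⁻¹ by positivity) (by ring)
    convert this using 1
    module
  have hin : Filter.Tendsto (fun n => (inner ℝ ((‖x (φ n) - p‖⁻¹ : ℝ) • (x (φ n) - p)) u : ℝ))
      Filter.atTop (nhds (inner ℝ u u : ℝ)) := Filter.Tendsto.inner hlim tendsto_const_nhds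
  rw [real_inner_self_eq_norm_sq, hu1] at hin
  obtain ⟨n, hn⟩ := (hin.eventually (lt_mem_nhds (show (0:ℝ) < 1 ^ 2 by norm_num))).exists
  rw [real_inner_smul_left] at hn
  have hs : 0 ≤ (inner ℝ (x (φ n) - p) u : ℝ) :=
    (pos_of_mul_pos_right hn (by have := hpos (φ n); positivity)).le
  obtain ⟨x₀, hb, hd⟩ := geom_aux (closure D) hconv.closure u p (x (φ n)) r hr hu1 hrec
    (hball.trans subset_closure) (hxC _) hs
  have hb' : Metric.ball x₀ (min r (1/2)) ⊆ D := by
    rw [← hint]; exact interior_maximal hb Metric.isOpen_ball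
  have := hx (φ n) x₀ hb'
  have h0 : (0:ℝ) ≤ (φ n : ℝ) := Nat.cast_nonneg _
  linarith
end
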